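/- arXiv:1104.1261 — 7 statements merged into one kernel-verified Lean document; each statement's English description precedes it below -/
import Mathlib

section
/- Let B be a strictly convex Banach space, let Γ be a group generated by a finite symmetric subset K with a weight m on K, let π be a linear isometric action of Γ on B with no nonzero fixed vector, and let 1 ≤ r < ∞. Then the following are equivalent: (1) there is a constant C' > 0 such that every v ∈ B satisfies max_{γ∈K} ‖π(γ)v − v‖ ≥ C'‖v‖; (2) there is a constant C > 0 such that every v ∈ B \ {0} satisfies |∇₋F_{π,r}|(v) ≥ C. -/
open Filter Topology

/-- Displacement function `F_{α,r}` (for `1 ≤ r < ∞`) of an action `α` with respect to a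
finite generating set `K` and a weight `m`. -/
noncomputable def dispR {Γ B : Type*} [NormedAddCommGroup B] (K : Finset Γ) (m : Γ → ℝ)
    (α : Γ → B → B) (r : ℝ) (v : B) : ℝ :=
  (∑ γ ∈ K, ‖α γ v - v‖ ^ r * m γ) ^ (1 / r)

/-- The absolute gradient `|∇₋F|(v) = max{limsup_{u→v, u≠v} (F v - F u)/‖v-u‖, 0}`. -/
noncomputable def absGrad {B : Type*} [NormedAddCommGroup B] (F : B → ℝ) (v : B) : ℝ :=
  max (Filter.limsup (fun u => (F v - F u) / ‖v - u‖) (𝓝[≠] v)) 0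

/-- **Ekeland's variational principle** for a nonnegative continuous function on a complete
metric space. -/
theorem exists_ekeland_point {X : Type*} [MetricSpace X] [CompleteSpace X] {F : X → ℝ}
    (hF : Continuous F) (hF0 : ∀ x, 0 ≤ F x) {c : ℝ} (hc : 0 < c) (x₀ : X) :
    ∃ w, F w + c * dist w x₀ ≤ F x₀ ∧ ∀ u, F u + c * dist u w ≤ F w → u = w := by
  have hbdd : ∀ x, BddBelow (F '' {u | F u + c * dist u x ≤ F x}) := fun x =>
    ⟨0, by rintro _ ⟨u, -, rfl⟩; exact hF0 u⟩
  have hstep : ∀ x, ∃ y, F y + c * dist y x ≤ F x ∧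
      ∀ u, F u + c * dist u x ≤ F x → 2 * F y - F x ≤ F u := by
    intro x
    have hx : F x ∈ F '' {u | F u + c * dist u x ≤ F x} := ⟨x, by simp, rfl⟩
    rcases (csInf_le (hbdd x) hx).eq_or_lt with h | h
    · refine ⟨x, by simp, fun u hu => ?_⟩
      have := csInf_le (hbdd x) ⟨u, hu, rfl⟩
      linarith
    · obtain ⟨_, ⟨y, hy, rfl⟩, hlt⟩ := exists_lt_of_csInf_lt ⟨_, hx⟩
        (show sInf (F '' {u | F u + c * dist u x ≤ F x}) <
          (F x + sInf (F '' {u | F u + c * dist u x ≤ F x})) / 2 by linarith)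
      refine ⟨y, hy, fun u hu => ?_⟩
      have := csInf_le (hbdd x) ⟨u, hu, rfl⟩
      linarith
  choose next hnext hinf using hstep
  let x : ℕ → X := fun n => next^[n] x₀
  have hxs : ∀ n, x (n + 1) = next (x n) := fun n => Function.iterate_succ_apply' next n x₀
  have htrans : ∀ {a b d : X}, F b + c * dist b a ≤ F a → F d + c * dist d b ≤ F b →
      F d + c * dist d a ≤ F a := by
    intro a b d hab hbd
    have := mul_le_mul_of_nonneg_left (dist_triangle d b a) hc.le
    linarith
  have hmem : ∀ {n k : ℕ}, n ≤ k → F (x k) + c * dist (x k) (x n) ≤ F (x n) := by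
    intro n k hnk
    induction k, hnk using Nat.le_induction with
    | base => simp
    | succ k _ ih => exact htrans ih (by rw [hxs]; exact hnext _)
  have hanti : Antitone (F ∘ x) := fun n k hnk => by
    have h1 := hmem hnk
    have h2 := mul_nonneg hc.le (dist_nonneg (x := x k) (y := x n))
    simp only [Function.comp_apply]
    linarith
  have hbddx : BddBelow (Set.range (F ∘ x)) := ⟨0, by rintro _ ⟨n, rfl⟩; exact hF0 _⟩
  have hlim := tendsto_atTop_ciInf hanti hbddx
  set L := ⨅ n, (F ∘ x) n
  have hcauchy : CauchySeq x := by
    refine cauchySeq_of_le_tendsto_0' (fun n => (F (x n) - L) / c) (fun n k hnk => ?_) ?_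
    · have h1 : L ≤ F (x k) := ciInf_le hbddx k
      rw [le_div_iff₀ hc, dist_comm]
      linarith [hmem hnk]
    · simpa using (hlim.sub_const L).div_const c
  obtain ⟨w, hw⟩ := cauchySeq_tendsto_of_complete hcauchy
  have hFw : F w = L := tendsto_nhds_unique ((hF.tendsto w).comp hw) hlim
  have hwmem : ∀ n, F w + c * dist w (x n) ≤ F (x n) := fun n =>
    le_of_tendsto (((hF.tendsto w).comp hw).add ((hw.dist tendsto_const_nhds).const_mul c))
      (eventually_atTop.2 ⟨n, fun k hk => hmem hk⟩)
  refine ⟨w, hwmem 0, fun u hu => ?_⟩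
  have hle : 2 * L - L ≤ F u := by
    refine le_of_tendsto ((((tendsto_add_atTop_iff_nat 1).2 hlim).const_mul 2).sub hlim)
      (Eventually.of_forall fun n => ?_)
    simp only [Function.comp_apply, hxs]
    exact hinf _ _ (htrans (hwmem n) hu)
  have : c * dist u w ≤ 0 := by linarith
  exact dist_le_zero.1 (nonpos_of_mul_nonpos_right this hc)

section absGrad

variable {B : Type*} [NormedAddCommGroup B] {F : B → ℝ} {L : NNReal}

theorem LipschitzWith.abs_slope_le (hF : LipschitzWith L F) (v u : B) :
    |(F v - F u) / ‖v - u‖| ≤ L := by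
  rw [abs_div, abs_norm]
  refine div_le_of_le_mul₀ (norm_nonneg _) L.2 ?_
  simpa [Real.dist_eq, dist_eq_norm] using hF.dist_le_mul v u

theorem le_absGrad_of_frequently (hF : LipschitzWith L F) {v : B} {c : ℝ}
    (h : ∃ᶠ u in 𝓝[≠] v, c ≤ (F v - F u) / ‖v - u‖) : c ≤ absGrad F v :=
  le_max_of_le_left <| le_limsup_of_frequently_le h <|
    isBoundedUnder_of ⟨L, fun u => (abs_le.1 (hF.abs_slope_le v u)).2⟩

theorem absGrad_le_of_eventually (hF : LipschitzWith L F) {v : B} [NeBot (𝓝[≠] v)] {c : ℝ}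
    (hc : 0 ≤ c) (h : ∀ᶠ u in 𝓝[≠] v, (F v - F u) / ‖v - u‖ ≤ c) : absGrad F v ≤ c := by
  refine max_le (limsup_le_of_le ?_ h) hc
  exact IsBoundedUnder.isCoboundedUnder_le <|
    isBoundedUnder_of ⟨-L, fun u => (abs_le.1 (hF.abs_slope_le v u)).1⟩

/-- If the absolute gradient of `F ≥ 0` exceeds `c` off the origin, then `F` dominates `c‖·‖`. -/
theorem mul_norm_le_of_lt_absGrad [NormedSpace ℝ B] [CompleteSpace B] (hF : LipschitzWith L F)
    (hF0 : ∀ v, 0 ≤ F v) {c : ℝ} (hc : 0 < c) (h : ∀ v ≠ 0, c < absGrad F v) (v : B) :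
    c * ‖v‖ ≤ F v := by
  obtain ⟨w, hwv, hw⟩ := exists_ekeland_point hF.continuous hF0 hc v
  have hw0 : w = 0 := by
    by_contra hne
    have : Nontrivial B := ⟨w, 0, hne⟩
    have : NeBot (𝓝[≠] w) := Module.punctured_nhds_neBot ℝ B w
    refine (h w hne).not_ge (absGrad_le_of_eventually hF hc.le ?_)
    filter_upwards [self_mem_nhdsWithin] with u hu
    have hpos : 0 < ‖w - u‖ := norm_pos_iff.2 (sub_ne_zero.2 (Ne.symm hu))
    rw [div_le_iff₀ hpos]
    by_contra! hlt
    refine hu (hw u ?_)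
    rw [dist_comm, dist_eq_norm]
    linarith
  rw [hw0, dist_zero_left] at hwv
  linarith [hF0 0]

/-- A Lipschitz homogeneous function has absolute gradient at least its radial slope. -/
theorem le_absGrad_of_homogeneous [NormedSpace ℝ B] (hF : LipschitzWith L F)
    (hhom : ∀ (t : ℝ) (v : B), 0 ≤ t → F (t • v) = t * F v) {v : B} (hv : v ≠ 0) :
    F v / ‖v‖ ≤ absGrad F v := by
  refine le_absGrad_of_frequently hF ?_
  have hlim : Tendsto (fun t : ℝ => (1 - t) • v) (𝓝[>] 0) (𝓝[≠] v) := by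
    refine tendsto_nhdsWithin_iff.2 ⟨?_, ?_⟩
    · have : Continuous fun t : ℝ => (1 - t) • v := by fun_prop
      simpa using (this.tendsto 0).mono_left nhdsWithin_le_nhds
    · filter_upwards [self_mem_nhdsWithin] with t (ht : 0 < t) heq
      rw [Set.mem_singleton_iff, sub_smul, one_smul, sub_eq_self, smul_eq_zero] at heq
      exact heq.elim ht.ne' hv
  refine hlim.frequently (Eventually.frequently ?_)
  filter_upwards [Ioo_mem_nhdsGT (zero_lt_one' ℝ)] with t ht
  have hsub : v - (1 - t) • v = t • v := by rw [sub_smul, one_smul, sub_sub_cancel]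
  have ht0 : t ≠ 0 := ht.1.ne'
  have hv0 : ‖v‖ ≠ 0 := norm_ne_zero_iff.2 hv
  rw [hhom _ _ (by linarith [ht.2]), hsub, norm_smul, Real.norm_of_nonneg ht.1.le]
  refine le_of_eq ?_
  field_simp
  ring

end absGrad

section dispR

variable {Γ B : Type*} [NormedAddCommGroup B] {K : Finset Γ} {m : Γ → ℝ} {r : ℝ}

theorem dispR_nonneg (hm : ∀ γ ∈ K, 0 ≤ m γ) (α : Γ → B → B) (v : B) : 0 ≤ dispR K m α r v :=
  Real.rpow_nonneg (Finset.sum_nonneg fun γ hγ =>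
    mul_nonneg (Real.rpow_nonneg (norm_nonneg _) _) (hm γ hγ)) _

theorem dispR_le (hm : ∀ γ ∈ K, 0 ≤ m γ) (hsum : ∑ γ ∈ K, m γ = 1) (hr : 1 ≤ r)
    {α : Γ → B → B} {v : B} {M : ℝ} (hM : 0 ≤ M) (h : ∀ γ ∈ K, ‖α γ v - v‖ ≤ M) :
    dispR K m α r v ≤ M := by
  have hr0 : 0 < r := by linarith
  have hle : ∑ γ ∈ K, ‖α γ v - v‖ ^ r * m γ ≤ M ^ r := by
    calc ∑ γ ∈ K, ‖α γ v - v‖ ^ r * m γ ≤ ∑ γ ∈ K, M ^ r * m γ :=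
          Finset.sum_le_sum fun γ hγ => mul_le_mul_of_nonneg_right
            (Real.rpow_le_rpow (norm_nonneg _) (h γ hγ) hr0.le) (hm γ hγ)
      _ = M ^ r := by rw [← Finset.mul_sum, hsum, mul_one]
  calc dispR K m α r v ≤ (M ^ r) ^ (1 / r) :=
        Real.rpow_le_rpow (Finset.sum_nonneg fun γ hγ =>
          mul_nonneg (Real.rpow_nonneg (norm_nonneg _) _) (hm γ hγ)) hle (by positivity)
    _ = M := by rw [one_div, Real.rpow_rpow_inv hM hr0.ne']

theorem mul_norm_le_dispR (hm : ∀ γ ∈ K, 0 ≤ m γ) (hsum : ∑ γ ∈ K, m γ = 1) (hr : 1 ≤ r)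
    (α : Γ → B → B) (v : B) {γ : Γ} (hγ : γ ∈ K) :
    m γ * ‖α γ v - v‖ ≤ dispR K m α r v := by
  calc m γ * ‖α γ v - v‖ ≤ ∑ γ ∈ K, m γ * ‖α γ v - v‖ :=
        Finset.single_le_sum (f := fun γ => m γ * ‖α γ v - v‖)
          (fun γ hγ => mul_nonneg (hm γ hγ) (norm_nonneg _)) hγ
    _ ≤ (∑ γ ∈ K, m γ * ‖α γ v - v‖ ^ r) ^ (1 / r) :=
        Real.arith_mean_le_rpow_mean K m _ hm hsum (fun _ _ => norm_nonneg _) hr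
    _ = dispR K m α r v := by simp only [dispR, mul_comm]

theorem dispR_le_add (hm : ∀ γ ∈ K, 0 ≤ m γ) (hsum : ∑ γ ∈ K, m γ = 1) (hr : 1 ≤ r)
    {α : Γ → B → B} {v u : B} {M : ℝ} (hM : 0 ≤ M)
    (h : ∀ γ ∈ K, ‖α γ v - v‖ ≤ ‖α γ u - u‖ + M) :
    dispR K m α r v ≤ dispR K m α r u + M := by
  have hr0 : 0 < r := by linarith
  have hpow : ∀ a : ℝ, 0 ≤ a → ∀ γ ∈ K, (a * m γ ^ (1 / r)) ^ r = a ^ r * m γ := by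
    intro a ha γ hγ
    rw [Real.mul_rpow ha (Real.rpow_nonneg (hm γ hγ) _), one_div,
      Real.rpow_inv_rpow (hm γ hγ) hr0.ne']
  have hmink := Real.Lp_add_le_of_nonneg (s := K) (f := fun γ => ‖α γ u - u‖ * m γ ^ (1 / r))
    (g := fun γ => M * m γ ^ (1 / r)) hr
    (fun γ hγ => mul_nonneg (norm_nonneg _) (Real.rpow_nonneg (hm γ hγ) _))
    (fun γ hγ => mul_nonneg hM (Real.rpow_nonneg (hm γ hγ) _))
  simp only [← add_mul] at hmink
  rw [Finset.sum_congr rfl fun γ hγ => hpow _ (add_nonneg (norm_nonneg (α γ u - u)) hM) γ hγ,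
    Finset.sum_congr rfl fun γ hγ => hpow _ (norm_nonneg (α γ u - u)) γ hγ,
    Finset.sum_congr rfl fun γ hγ => hpow _ hM γ hγ, ← Finset.mul_sum, hsum, mul_one,
    one_div, Real.rpow_rpow_inv hM hr0.ne', ← one_div] at hmink
  refine le_trans (Real.rpow_le_rpow (Finset.sum_nonneg fun γ hγ =>
    mul_nonneg (Real.rpow_nonneg (norm_nonneg _) _) (hm γ hγ)) ?_ (by positivity)) hmink
  exact Finset.sum_le_sum fun γ hγ => mul_le_mul_of_nonneg_right
    (Real.rpow_le_rpow (norm_nonneg _) (h γ hγ) hr0.le) (hm γ hγ)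

variable [NormedSpace ℝ B]

theorem lipschitzWith_dispR (hm : ∀ γ ∈ K, 0 ≤ m γ) (hsum : ∑ γ ∈ K, m γ = 1) (hr : 1 ≤ r)
    (π : Γ → B ≃ₗᵢ[ℝ] B) : LipschitzWith 2 (dispR K m (fun γ w => π γ w) r) := by
  refine LipschitzWith.of_le_add_mul 2 fun v u => ?_
  refine dispR_le_add hm hsum hr (by positivity) fun γ _ => ?_
  have heq : π γ v - v = (π γ u - u) + (π γ (v - u) - (v - u)) := by rw [map_sub]; abel
  have h2 := norm_sub_le (π γ (v - u)) (v - u)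
  rw [LinearIsometryEquiv.norm_map] at h2
  calc ‖π γ v - v‖ ≤ ‖π γ u - u‖ + ‖π γ (v - u) - (v - u)‖ := by rw [heq]; exact norm_add_le _ _
    _ ≤ ‖π γ u - u‖ + (2 : NNReal) * dist v u := by
        rw [dist_eq_norm, NNReal.coe_ofNat]; linarith

theorem dispR_smul (hm : ∀ γ ∈ K, 0 ≤ m γ) (hr : 1 ≤ r) (π : Γ → B ≃ₗᵢ[ℝ] B) {t : ℝ}
    (ht : 0 ≤ t) (v : B) :
    dispR K m (fun γ w => π γ w) r (t • v) = t * dispR K m (fun γ w => π γ w) r v := by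
  have hr0 : 0 < r := by linarith
  have hterm : ∀ γ, ‖π γ (t • v) - t • v‖ ^ r * m γ = t ^ r * (‖π γ v - v‖ ^ r * m γ) := by
    intro γ
    rw [map_smul, ← smul_sub, norm_smul, Real.norm_of_nonneg ht,
      Real.mul_rpow ht (norm_nonneg _), mul_assoc]
  simp only [dispR, hterm, ← Finset.mul_sum]
  rw [Real.mul_rpow (Real.rpow_nonneg ht _) (Finset.sum_nonneg fun γ hγ =>
    mul_nonneg (Real.rpow_nonneg (norm_nonneg _) _) (hm γ hγ)), one_div,
    Real.rpow_rpow_inv ht hr0.ne']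

end dispR

theorem stmt0 {B : Type*} [NormedAddCommGroup B] [NormedSpace ℝ B] [CompleteSpace B]
    -- `B` is strictly convex:
    (hB : ∀ v u : B, v ≠ u → ‖v‖ ≤ 1 → ‖u‖ ≤ 1 → ‖v + u‖ < 2)
    {Γ : Type*} [Group Γ] (K : Finset Γ) (hKne : K.Nonempty)
    (hKsym : ∀ γ ∈ K, γ⁻¹ ∈ K)
    (hKgen : Subgroup.closure (K : Set Γ) = ⊤)
    (m : Γ → ℝ) (hmpos : ∀ γ ∈ K, 0 < m γ) (hmsum : ∑ γ ∈ K, m γ = 1)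
    -- `π` is a linear isometric action with no nonzero fixed vector:
    (π : Γ →* (B ≃ₗᵢ[ℝ] B)) (hπ : ∀ v : B, (∀ γ : Γ, π γ v = v) → v = 0)
    (r : ℝ) (hr : 1 ≤ r) :
    (∃ C' > (0 : ℝ), ∀ v : B, C' * ‖v‖ ≤ K.sup' hKne fun γ => ‖π γ v - v‖) ↔
      (∃ C > (0 : ℝ), ∀ v : B, v ≠ 0 →
        C ≤ absGrad (dispR K m (fun γ w => π γ w) r) v) := by
  have hm : ∀ γ ∈ K, 0 ≤ m γ := fun γ hγ => (hmpos γ hγ).le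
  have hLip := lipschitzWith_dispR hm hmsum hr π
  constructor
  · rintro ⟨C', hC', h⟩
    obtain ⟨γ₁, hγ₁, hmin⟩ := K.exists_min_image m hKne
    refine ⟨m γ₁ * C', mul_pos (hmpos γ₁ hγ₁) hC', fun v hv => ?_⟩
    refine le_trans ?_ (le_absGrad_of_homogeneous hLip (fun t v ht => dispR_smul hm hr π ht v) hv)
    rw [le_div_iff₀ (norm_pos_iff.2 hv)]
    obtain ⟨γ₀, hγ₀, hsup⟩ := K.exists_mem_eq_sup' hKne fun γ => ‖π γ v - v‖
    calc m γ₁ * C' * ‖v‖ = m γ₁ * (C' * ‖v‖) := mul_assoc _ _ _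
      _ ≤ m γ₀ * ‖π γ₀ v - v‖ :=
          mul_le_mul (hmin γ₀ hγ₀) (hsup ▸ h v) (by positivity) (hm γ₀ hγ₀)
      _ ≤ _ := mul_norm_le_dispR hm hmsum hr (fun γ w => π γ w) v hγ₀
  · rintro ⟨C, hC, h⟩
    refine ⟨C / 2, half_pos hC, fun v => ?_⟩
    refine (mul_norm_le_of_lt_absGrad hLip (fun v => dispR_nonneg hm _ v) (half_pos hC)
      (fun v hv => (half_lt_self hC).trans_le (h v hv)) v).trans ?_
    obtain ⟨γ₀, hγ₀⟩ := hKne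
    exact dispR_le hm hmsum hr ((norm_nonneg _).trans
      (Finset.le_sup' (fun γ => ‖π γ v - v‖) hγ₀)) fun γ hγ =>
        Finset.le_sup' (fun γ => ‖π γ v - v‖) hγ
end

section
/- Let B be a strictly convex Banach space, let Γ be a group generated by a finite symmetric subset K with a weight m on K, let π be a linear isometric action of Γ on B with no nonzero fixed vector, and let 1 ≤ r < ∞. Then the following are equivalent: (1) every affine isometric action α ∈ A(π) has a fixed point; (2) for every α ∈ A(π) there is a constant C > 0 such that every v ∈ B with F_{α,r}(v) > 0 satisfies |∇₋F_{α,r}|(v) ≥ C. -/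
open Filter Topology

/-- A nonnegative continuous function on a complete metric space has, for every `ε > 0`, a point
at which it decreases with slope at most `ε` (a form of Ekeland's variational principle). -/
theorem exists_forall_le_add_mul_dist {X : Type*} [MetricSpace X] [CompleteSpace X] [Nonempty X]
    {F : X → ℝ} (hF : Continuous F) (h0 : ∀ x, 0 ≤ F x) {ε : ℝ} (hε : 0 < ε) :
    ∃ v, ∀ u, F v ≤ F u + ε * dist v u := by
  by_contra! hcon
  have step : ∀ (n : ℕ) (x : X), ∃ y, F y + ε * dist x y ≤ F x ∧
      ∀ u, F u + ε * dist x u ≤ F x → F y ≤ F u + 1 / ((n : ℝ) + 1) := by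
    intro n x
    have hb : BddBelow (F '' {u | F u + ε * dist x u ≤ F x}) :=
      ⟨0, by rintro _ ⟨u, -, rfl⟩; exact h0 u⟩
    have hne : (F '' {u | F u + ε * dist x u ≤ F x}).Nonempty := ⟨F x, x, by simp, rfl⟩
    obtain ⟨_, ⟨y, hy, rfl⟩, hlt⟩ := exists_lt_of_csInf_lt hne
      (lt_add_of_pos_right _ (Nat.one_div_pos_of_nat (α := ℝ) (n := n)))
    refine ⟨y, hy, fun u hu => hlt.le.trans ?_⟩
    gcongr
    exact csInf_le hb ⟨u, hu, rfl⟩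
  choose f hf1 hf2 using step
  obtain ⟨x₀⟩ := ‹Nonempty X›
  let x : ℕ → X := fun n => Nat.rec x₀ (fun k y => f k y) n
  have hx : ∀ n, x (n + 1) = f n (x n) := fun n => rfl
  have hle : ∀ n m, n ≤ m → F (x m) + ε * dist (x n) (x m) ≤ F (x n) := by
    intro n m hnm
    induction m, hnm using Nat.le_induction with
    | base => simp
    | succ k hk ih =>
      have h1 := hf1 k (x k)
      rw [← hx] at h1
      have h2 := mul_le_mul_of_nonneg_left (dist_triangle (x n) (x k) (x (k + 1))) hε.le
      linarith
  have hanti : Antitone fun n => F (x n) := fun n m hnm => by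
    have := hle n m hnm
    have := mul_nonneg hε.le (dist_nonneg (x := x n) (y := x m))
    dsimp only
    linarith
  have hbdd : BddBelow (Set.range fun n => F (x n)) := ⟨0, by rintro _ ⟨n, rfl⟩; exact h0 _⟩
  have hlim := tendsto_atTop_ciInf hanti hbdd
  set L := ⨅ n, F (x n)
  have hcau : CauchySeq x := by
    refine cauchySeq_of_le_tendsto_0' (fun n => (F (x n) - L) / ε) (fun n m hnm => ?_) ?_
    · rw [le_div_iff₀ hε]
      have := hle n m hnm
      have := ciInf_le hbdd m
      linarith
    · simpa using (hlim.sub_const L).div_const ε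
  obtain ⟨v, hv⟩ := cauchySeq_tendsto_of_complete hcau
  have hFv : Tendsto (fun n => F (x n)) atTop (𝓝 (F v)) := (hF.tendsto v).comp hv
  have hmem : ∀ n, F v + ε * dist (x n) v ≤ F (x n) := fun n =>
    le_of_tendsto (hFv.add ((tendsto_const_nhds.dist hv).const_mul ε))
      (eventually_atTop.2 ⟨n, fun m hm => hle n m hm⟩)
  obtain ⟨u, hu⟩ := hcon v
  have hstep : ∀ n, F (x (n + 1)) ≤ F u + 1 / ((n : ℝ) + 1) := fun n => by
    refine hf2 n (x n) u ?_
    have := mul_le_mul_of_nonneg_left (dist_triangle (x n) v u) hε.le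
    linarith [hmem n]
  have hFu : F v ≤ F u + 0 :=
    le_of_tendsto_of_tendsto' (hFv.comp (tendsto_add_atTop_nat 1))
      (tendsto_const_nhds.add tendsto_one_div_add_atTop_nhds_zero_nat) hstep
  have := mul_nonneg hε.le (dist_nonneg (x := v) (y := u))
  linarith

section absGrad

variable {B : Type*} [NormedAddCommGroup B] {F : B → ℝ} {L C : ℝ} {v : B}

theorem absGrad_le (hL : ∀ u, F u - F v ≤ L * ‖v - u‖) (hC0 : 0 ≤ C)
    (hC : ∀ u, F v - F u ≤ C * ‖v - u‖) : absGrad F v ≤ C := by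
  refine max_le ?_ hC0
  rcases (𝓝[≠] v).eq_or_neBot with h | h
  · simpa [h, limsup, limsSup] using hC0
  · refine limsup_le_of_le ?_ ?_
    · refine IsCoboundedUnder.of_frequently_ge (a := -L) (Eventually.frequently ?_)
      filter_upwards [self_mem_nhdsWithin] with u hu
      rw [le_div_iff₀ (norm_pos_iff.2 (sub_ne_zero.2 (Ne.symm hu)))]
      linarith [hL u]
    · filter_upwards [self_mem_nhdsWithin] with u hu
      rw [div_le_iff₀ (norm_pos_iff.2 (sub_ne_zero.2 (Ne.symm hu)))]
      exact hC u

theorem le_absGrad (hL : ∀ u, F v - F u ≤ L * ‖v - u‖)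
    (hC : ∃ᶠ u in 𝓝[≠] v, C * ‖v - u‖ ≤ F v - F u) : C ≤ absGrad F v := by
  refine le_max_of_le_left (le_limsup_of_frequently_le ?_ ?_)
  · refine (hC.and_eventually self_mem_nhdsWithin).mono fun u ⟨hu, hne⟩ => ?_
    rwa [le_div_iff₀ (norm_pos_iff.2 (sub_ne_zero.2 (Ne.symm hne)))]
  · refine isBoundedUnder_of_eventually_le (a := L) ?_
    filter_upwards [self_mem_nhdsWithin] with u hu
    rw [div_le_iff₀ (norm_pos_iff.2 (sub_ne_zero.2 (Ne.symm hu)))]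
    exact hL u

end absGrad

/-- The weighted `ℓ^r` norm of a `B`-valued function on the finite set `K`. -/
noncomputable def weightedNorm {Γ B : Type*} [NormedAddCommGroup B] (K : Finset Γ) (m : Γ → ℝ)
    (r : ℝ) (x : Γ → B) : ℝ :=
  (∑ γ ∈ K, ‖x γ‖ ^ r * m γ) ^ (1 / r)

section weightedNorm

variable {Γ B : Type*} [NormedAddCommGroup B] {K : Finset Γ} {m : Γ → ℝ} {r : ℝ}

theorem weightedNorm_nonneg (hm : ∀ γ ∈ K, 0 < m γ) (x : Γ → B) : 0 ≤ weightedNorm K m r x :=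
  Real.rpow_nonneg (Finset.sum_nonneg fun γ hγ =>
    mul_nonneg (Real.rpow_nonneg (norm_nonneg _) _) (hm γ hγ).le) _

theorem weightedNorm_add_le (hm : ∀ γ ∈ K, 0 < m γ) (hr : 1 ≤ r) (x y : Γ → B) :
    weightedNorm K m r (x + y) ≤ weightedNorm K m r x + weightedNorm K m r y := by
  have hr0 : r ≠ 0 := by positivity
  have key : ∀ a : Γ → ℝ, (∀ γ, 0 ≤ a γ) →
      ∑ γ ∈ K, a γ ^ r * m γ = ∑ γ ∈ K, |a γ * m γ ^ (1 / r)| ^ r := fun a ha =>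
    Finset.sum_congr rfl fun γ hγ => by
      have h1 := Real.rpow_nonneg (hm γ hγ).le (1 / r)
      rw [abs_of_nonneg (mul_nonneg (ha γ) h1), Real.mul_rpow (ha γ) h1, ← Real.rpow_mul (hm γ hγ).le,
        one_div_mul_cancel hr0, Real.rpow_one]
  calc weightedNorm K m r (x + y)
      ≤ (∑ γ ∈ K, (‖x γ‖ + ‖y γ‖) ^ r * m γ) ^ (1 / r) := by
        refine Real.rpow_le_rpow (Finset.sum_nonneg fun γ hγ =>
          mul_nonneg (Real.rpow_nonneg (norm_nonneg _) _) (hm γ hγ).le) ?_ (by positivity)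
        refine Finset.sum_le_sum fun γ hγ => mul_le_mul_of_nonneg_right ?_ (hm γ hγ).le
        exact Real.rpow_le_rpow (norm_nonneg _) (norm_add_le _ _) (by positivity)
    _ ≤ weightedNorm K m r x + weightedNorm K m r y := by
        rw [weightedNorm, weightedNorm, key _ fun _ => by positivity, key _ fun _ => norm_nonneg _,
          key _ fun _ => norm_nonneg _]
        simp only [add_mul]
        exact Real.Lp_add_le _ _ _ hr

theorem weightedNorm_le (hm : ∀ γ ∈ K, 0 < m γ) (hsum : ∑ γ ∈ K, m γ = 1) (hr : 1 ≤ r)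
    {x : Γ → B} {a : ℝ} (ha : 0 ≤ a) (hx : ∀ γ ∈ K, ‖x γ‖ ≤ a) : weightedNorm K m r x ≤ a := by
  have hr0 : r ≠ 0 := by positivity
  calc weightedNorm K m r x ≤ (∑ γ ∈ K, a ^ r * m γ) ^ (1 / r) := by
        refine Real.rpow_le_rpow (Finset.sum_nonneg fun γ hγ =>
          mul_nonneg (Real.rpow_nonneg (norm_nonneg _) _) (hm γ hγ).le) ?_ (by positivity)
        refine Finset.sum_le_sum fun γ hγ => mul_le_mul_of_nonneg_right ?_ (hm γ hγ).le
        exact Real.rpow_le_rpow (norm_nonneg _) (hx γ hγ) (by positivity)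
    _ = a := by
        rw [← Finset.mul_sum, hsum, mul_one, ← Real.rpow_mul ha, mul_one_div_cancel hr0,
          Real.rpow_one]

theorem weight_rpow_mul_norm_le (hm : ∀ γ ∈ K, 0 < m γ) (hr : 1 ≤ r) (x : Γ → B) {γ : Γ}
    (hγ : γ ∈ K) : m γ ^ (1 / r) * ‖x γ‖ ≤ weightedNorm K m r x := by
  have hr0 : r ≠ 0 := by positivity
  have h : ‖x γ‖ ^ r * m γ ≤ ∑ γ ∈ K, ‖x γ‖ ^ r * m γ :=
    Finset.single_le_sum (f := fun γ => ‖x γ‖ ^ r * m γ)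
      (fun γ hγ => mul_nonneg (Real.rpow_nonneg (norm_nonneg _) _) (hm γ hγ).le) hγ
  calc m γ ^ (1 / r) * ‖x γ‖ = (‖x γ‖ ^ r * m γ) ^ (1 / r) := by
        rw [Real.mul_rpow (by positivity) (hm γ hγ).le, ← Real.rpow_mul (norm_nonneg _),
          mul_one_div_cancel hr0, Real.rpow_one, mul_comm]
    _ ≤ _ := Real.rpow_le_rpow (mul_nonneg (by positivity) (hm γ hγ).le) h (by positivity)

theorem exists_pos_mul_norm_le_weightedNorm (hm : ∀ γ ∈ K, 0 < m γ) (hr : 1 ≤ r) :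
    ∃ δ > 0, ∀ x : Γ → B, ∀ γ ∈ K, δ * ‖x γ‖ ≤ weightedNorm K m r x := by
  rcases K.eq_empty_or_nonempty with rfl | hK
  · exact ⟨1, one_pos, by simp⟩
  obtain ⟨γ₀, h₀, hmin⟩ := K.exists_min_image (fun γ => m γ ^ (1 / r)) hK
  exact ⟨_, Real.rpow_pos_of_pos (hm γ₀ h₀) (1 / r), fun x γ hγ =>
    (mul_le_mul_of_nonneg_right (hmin γ hγ) (norm_nonneg _)).trans
      (weight_rpow_mul_norm_le hm hr x hγ)⟩

theorem weightedNorm_smul [NormedSpace ℝ B] (hm : ∀ γ ∈ K, 0 < m γ) (hr : 1 ≤ r) {t : ℝ}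
    (ht : 0 ≤ t) (x : Γ → B) : weightedNorm K m r (t • x) = t * weightedNorm K m r x := by
  have hr0 : r ≠ 0 := by positivity
  simp only [weightedNorm, Pi.smul_apply, norm_smul, Real.norm_of_nonneg ht,
    Real.mul_rpow ht (norm_nonneg _), mul_assoc, ← Finset.mul_sum]
  rw [Real.mul_rpow (by positivity) (Finset.sum_nonneg fun γ hγ =>
    mul_nonneg (Real.rpow_nonneg (norm_nonneg _) _) (hm γ hγ).le), ← Real.rpow_mul ht,
    mul_one_div_cancel hr0, Real.rpow_one]

end weightedNorm

section action

variable {B : Type*} [NormedAddCommGroup B] [NormedSpace ℝ B] {Γ : Type*} [Group Γ]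
  {K : Finset Γ} {m : Γ → ℝ} {r : ℝ} {π : Γ →* (B ≃ₗᵢ[ℝ] B)} {c : Γ → B}

theorem dispR_sub_le (hm : ∀ γ ∈ K, 0 < m γ) (hsum : ∑ γ ∈ K, m γ = 1) (hr : 1 ≤ r) (v u : B) :
    dispR K m (fun γ w => π γ w + c γ) r v - dispR K m (fun γ w => π γ w + c γ) r u ≤
      2 * ‖v - u‖ := by
  have h := weightedNorm_add_le hm hr (fun γ => π γ u + c γ - u) (fun γ => π γ (v - u) - (v - u))
  have h2 : weightedNorm K m r (fun γ => π γ (v - u) - (v - u)) ≤ 2 * ‖v - u‖ := by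
    refine weightedNorm_le hm hsum hr (by positivity) fun γ _ => (norm_sub_le _ _).trans ?_
    rw [LinearIsometryEquiv.norm_map, two_mul]
  have h3 : (fun γ => π γ u + c γ - u) + (fun γ => π γ (v - u) - (v - u)) =
      fun γ => π γ v + c γ - v := by
    funext γ
    simp only [Pi.add_apply, map_sub]
    abel
  rw [h3] at h
  change weightedNorm K m r (fun γ => π γ v + c γ - v) -
    weightedNorm K m r (fun γ => π γ u + c γ - u) ≤ _
  linarith

theorem map_mul_apply_linearIsometryEquiv (x y : Γ) (v : B) : π (x * y) v = π x (π y v) := by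
  rw [map_mul]
  rfl

theorem map_inv_apply_map_apply (x : Γ) (v : B) : π x⁻¹ (π x v) = v := by
  rw [← map_mul_apply_linearIsometryEquiv, inv_mul_cancel, map_one]
  rfl

theorem forall_fixed_of_dispR_eq_zero (hm : ∀ γ ∈ K, 0 < m γ) (hr : 1 ≤ r)
    (hK : Subgroup.closure (K : Set Γ) = ⊤) (hc : ∀ γ γ' : Γ, c (γ * γ') = π γ (c γ') + c γ)
    {v : B} (hv : dispR K m (fun γ w => π γ w + c γ) r v = 0) (γ : Γ) : π γ v + c γ = v := by
  have hc1 : c 1 = 0 := by simpa using hc 1 1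
  induction (hK ▸ Subgroup.mem_top γ : γ ∈ Subgroup.closure (K : Set Γ))
    using Subgroup.closure_induction with
  | mem γ hγ =>
    have h := weight_rpow_mul_norm_le hm hr (fun γ => π γ v + c γ - v) hγ
    have h' : m γ ^ (1 / r) * ‖π γ v + c γ - v‖ ≤ 0 := h.trans hv.le
    have hpos := Real.rpow_pos_of_pos (hm γ hγ) (1 / r)
    have := nonpos_of_mul_nonpos_right h' hpos
    exact sub_eq_zero.1 (norm_le_zero_iff.1 this)
  | one => simp [hc1]
  | mul x y _ _ hx hy =>
    rw [hc, map_mul_apply_linearIsometryEquiv, ← add_assoc, ← map_add, hy, hx]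
  | inv x _ hx =>
    have h := hc x⁻¹ x
    rw [inv_mul_cancel, hc1] at h
    have h3 := congrArg (π x⁻¹) hx
    rw [map_add, map_inv_apply_map_apply] at h3
    rw [← h3, add_assoc, ← h, add_zero]

/-- The coboundary operator of `π`, restricted to `K`. -/
noncomputable def coboundary (K : Finset Γ) (π : Γ →* (B ≃ₗᵢ[ℝ] B)) : B →L[ℝ] (K → B) :=
  ContinuousLinearMap.pi fun γ =>
    ((π γ).toContinuousLinearEquiv : B →L[ℝ] B) - ContinuousLinearMap.id ℝ B

theorem coboundary_apply (v : B) (γ : K) : coboundary K π v γ = π γ v - v := rfl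

theorem isClosed_range_coboundary [CompleteSpace B] (hK : Subgroup.closure (K : Set Γ) = ⊤)
    (hfix : ∀ c : Γ → B, (∀ γ γ' : Γ, c (γ * γ') = π γ (c γ') + c γ) →
        ∃ v : B, ∀ γ : Γ, π γ v + c γ = v) :
    IsClosed (Set.range (coboundary K π)) := by
  refine IsSeqClosed.isClosed fun x f hx hf => ?_
  choose v hv using hx
  have hlim : ∀ γ : Γ, ∃ l, Tendsto (fun n => π γ (v n) - v n) atTop (𝓝 l) := by
    intro γ
    induction (hK ▸ Subgroup.mem_top γ : γ ∈ Subgroup.closure (K : Set Γ))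
      using Subgroup.closure_induction with
    | mem γ hγ =>
      refine ⟨f ⟨γ, hγ⟩, ((tendsto_pi_nhds.1 hf) ⟨γ, hγ⟩).congr fun n => ?_⟩
      rw [← hv, coboundary_apply]
    | one => exact ⟨0, by simp⟩
    | mul x y _ _ hx hy =>
      obtain ⟨a, ha⟩ := hx
      obtain ⟨b, hb⟩ := hy
      refine ⟨_, ((((π x).continuous.tendsto b).comp hb).add ha).congr fun n => ?_⟩
      simp
    | inv x _ hx =>
      obtain ⟨a, ha⟩ := hx
      refine ⟨_, (((π x⁻¹).continuous.tendsto a).comp ha).neg.congr fun n => ?_⟩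
      rw [Function.comp_apply, map_sub, map_inv_apply_map_apply, neg_sub]
  choose c hc using hlim
  obtain ⟨w, hw⟩ := hfix c fun x y => by
    refine tendsto_nhds_unique (hc (x * y))
      (((((π x).continuous.tendsto _).comp (hc y)).add (hc x)).congr fun n => ?_)
    simp
  refine ⟨-w, funext fun γ => tendsto_nhds_unique ?_ ((tendsto_pi_nhds.1 hf) γ)⟩
  have h1 : coboundary K π (-w) γ = c γ := by
    rw [coboundary_apply, map_neg]
    nth_rewrite 2 [← hw γ]
    abel
  rw [h1]
  refine (hc γ).congr fun n => ?_
  rw [← hv, coboundary_apply]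

theorem injective_coboundary (hK : Subgroup.closure (K : Set Γ) = ⊤)
    (hπ : ∀ v : B, (∀ γ : Γ, π γ v = v) → v = 0) : Function.Injective (coboundary K π) := by
  refine (injective_iff_map_eq_zero _).2 fun v hv => hπ v fun γ => ?_
  induction (hK ▸ Subgroup.mem_top γ : γ ∈ Subgroup.closure (K : Set Γ))
    using Subgroup.closure_induction with
  | mem γ hγ => exact sub_eq_zero.1 (congrFun hv ⟨γ, hγ⟩)
  | one => simp
  | mul x y _ _ hx hy => rw [map_mul_apply_linearIsometryEquiv, hy, hx]
  | inv x _ hx =>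
    nth_rewrite 1 [← hx]
    exact map_inv_apply_map_apply x v

theorem exists_pos_mul_norm_le_weightedNorm_coboundary [CompleteSpace B]
    (hK : Subgroup.closure (K : Set Γ) = ⊤) (hm : ∀ γ ∈ K, 0 < m γ) (hr : 1 ≤ r)
    (hπ : ∀ v : B, (∀ γ : Γ, π γ v = v) → v = 0)
    (hfix : ∀ c : Γ → B, (∀ γ γ' : Γ, c (γ * γ') = π γ (c γ') + c γ) →
        ∃ v : B, ∀ γ : Γ, π γ v + c γ = v) :
    ∃ C > 0, ∀ v : B, C * ‖v‖ ≤ weightedNorm K m r fun γ => π γ v - v := by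
  obtain ⟨M, hM⟩ := (coboundary K π).antilipschitz_of_injective_of_isClosed_range
    (injective_coboundary hK hπ) (isClosed_range_coboundary hK hfix)
  obtain ⟨δ, hδ, hle⟩ := exists_pos_mul_norm_le_weightedNorm (B := B) hm hr
  refine ⟨δ / (M + 1), by positivity, fun v => ?_⟩
  have h1 : ‖v‖ ≤ M * ‖coboundary K π v‖ := by
    simpa [dist_zero_right] using hM.le_mul_dist v 0
  have h2 : ‖coboundary K π v‖ ≤ (weightedNorm K m r fun γ => π γ v - v) / δ := by
    refine (pi_norm_le_iff_of_nonneg (div_nonneg (weightedNorm_nonneg hm _) hδ.le)).2 fun γ => ?_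
    rw [le_div_iff₀ hδ, mul_comm]
    exact hle (fun γ => π γ v - v) γ γ.2
  have h3 : ‖v‖ ≤ (M + 1) * ((weightedNorm K m r fun γ => π γ v - v) / δ) :=
    h1.trans (mul_le_mul (by linarith) h2 (norm_nonneg _) (by positivity))
  rw [div_mul_eq_mul_div, div_le_iff₀ (by positivity)]
  calc δ * ‖v‖ ≤ δ * ((M + 1) * ((weightedNorm K m r fun γ => π γ v - v) / δ)) := by gcongr
    _ = _ := by field_simp

end action

/-- Affine isometric actions with linear part `π` correspond exactly to `π`-cocycles
`c : Γ → B` via `α(γ)v = π(γ)v + c(γ)`. -/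
theorem stmt2 {B : Type*} [NormedAddCommGroup B] [NormedSpace ℝ B] [CompleteSpace B]
    -- `B` is strictly convex:
    (hB : ∀ v u : B, v ≠ u → ‖v‖ ≤ 1 → ‖u‖ ≤ 1 → ‖v + u‖ < 2)
    {Γ : Type*} [Group Γ] (K : Finset Γ)
    (hKsym : ∀ γ ∈ K, γ⁻¹ ∈ K)
    (hKgen : Subgroup.closure (K : Set Γ) = ⊤)
    (m : Γ → ℝ) (hmpos : ∀ γ ∈ K, 0 < m γ) (hmsum : ∑ γ ∈ K, m γ = 1)
    -- `π` is a linear isometric action with no nonzero fixed vector: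
    (π : Γ →* (B ≃ₗᵢ[ℝ] B)) (hπ : ∀ v : B, (∀ γ : Γ, π γ v = v) → v = 0)
    (r : ℝ) (hr : 1 ≤ r) :
    -- (1) every affine isometric action with linear part `π` has a fixed point
    (∀ c : Γ → B, (∀ γ γ' : Γ, c (γ * γ') = π γ (c γ') + c γ) →
        ∃ v : B, ∀ γ : Γ, π γ v + c γ = v) ↔
      -- (2) for every such action the absolute gradient of `F_{α,r}` is uniformly positive
      -- away from the zero set of `F_{α,r}`
      (∀ c : Γ → B, (∀ γ γ' : Γ, c (γ * γ') = π γ (c γ') + c γ) →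
        ∃ C > (0 : ℝ), ∀ v : B,
          0 < dispR K m (fun γ w => π γ w + c γ) r v →
            C ≤ absGrad (dispR K m (fun γ w => π γ w + c γ) r) v) := by
  constructor
  · intro hfix c hc
    obtain ⟨C, hC, hle⟩ := exists_pos_mul_norm_le_weightedNorm_coboundary hKgen hmpos hr hπ hfix
    refine ⟨C, hC, fun v hv => ?_⟩
    obtain ⟨w, hw⟩ := hfix c hc
    have hF : ∀ u, dispR K m (fun γ w => π γ w + c γ) r u =
        weightedNorm K m r fun γ => π γ (u - w) - (u - w) := fun u => by
      refine congrArg (weightedNorm K m r) (funext fun γ => ?_)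
      dsimp only
      rw [map_sub, eq_sub_of_add_eq' (hw γ)]
      abel
    refine le_absGrad (L := 2) (fun u => dispR_sub_le hmpos hmsum hr v u) ?_
    have hne : v - w ≠ 0 := fun h => by
      rw [hF, h] at hv
      have := weightedNorm_le (K := K) hmpos hmsum hr le_rfl (x := fun γ => π γ (0 : B) - 0)
        (by simp)
      linarith
    have hpath : Tendsto (fun t : ℝ => v - t • (v - w)) (𝓝[>] 0) (𝓝[≠] v) := by
      refine tendsto_nhdsWithin_iff.2 ⟨?_, ?_⟩
      · have : Continuous fun t : ℝ => v - t • (v - w) := by fun_prop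
        simpa using (this.tendsto 0).mono_left nhdsWithin_le_nhds
      · filter_upwards [self_mem_nhdsWithin] with t ht h
        exact (smul_ne_zero (ne_of_gt ht) hne) (sub_eq_self.1 h)
    refine hpath.frequently (Eventually.frequently ?_)
    filter_upwards [Ioc_mem_nhdsGT (zero_lt_one' ℝ)] with t ht
    have h1 : (fun γ => π γ (v - t • (v - w) - w) - (v - t • (v - w) - w)) =
        (1 - t) • fun γ => π γ (v - w) - (v - w) := by
      have h2 : v - t • (v - w) - w = (1 - t) • (v - w) := by module
      funext γ
      rw [h2, Pi.smul_apply, map_smul, smul_sub (1 - t) (π γ (v - w))]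
    rw [hF, hF, h1, weightedNorm_smul hmpos hr (by linarith [ht.2]), sub_sub_cancel, norm_smul,
      Real.norm_of_nonneg ht.1.le]
    have := mul_le_mul_of_nonneg_left (hle (v - w)) ht.1.le
    linarith
  · intro h c hc
    obtain ⟨C, hC, hgrad⟩ := h c hc
    have hlip := dispR_sub_le (π := π) (c := c) hmpos hmsum hr
    have hnn : ∀ v, 0 ≤ dispR K m (fun γ w => π γ w + c γ) r v := fun v =>
      weightedNorm_nonneg hmpos _
    have hcont : Continuous (dispR K m (fun γ w => π γ w + c γ) r) :=
      (LipschitzWith.of_le_add_mul 2 fun x y => by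
        rw [dist_eq_norm]
        have := hlip x y
        push_cast
        linarith).continuous
    obtain ⟨v, hv⟩ := exists_forall_le_add_mul_dist hcont hnn (half_pos hC)
    refine ⟨v, forall_fixed_of_dispR_eq_zero hmpos hr hKgen hc ?_⟩
    by_contra hne
    have h1 := hgrad v ((hnn v).lt_of_ne' hne)
    have h2 : absGrad (dispR K m (fun γ w => π γ w + c γ) r) v ≤ C / 2 := by
      refine absGrad_le (L := 2) (fun u => ?_) (half_pos hC).le fun u => ?_
      · rw [norm_sub_rev]
        exact hlip u v
      · have := hv u
        rw [dist_eq_norm] at this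
        linarith
    linarith
end

section
/- Let B be a uniformly smooth Banach space in which every nonzero vector has a unique support functional, with duality map j. Then for all v, u ∈ B \ {0} with v/‖v‖ ≠ u/‖u‖, one has ‖Re j(v) − Re j(u)‖_{B*} ≤ 2 ρ_B(2‖v/‖v‖ − u/‖u‖‖) / ‖v/‖v‖ − u/‖u‖‖, where Re f denotes the real-valued part of a functional f ∈ B*. -/
open Filter Topology

/-- The modulus of smoothness `ρ_B(τ)` of a normed space `B`. -/
noncomputable def modSmooth (B : Type*) [NormedAddCommGroup B] (τ : ℝ) : ℝ :=
  sSup {s : ℝ | ∃ u v : B, ‖u‖ ≤ 1 ∧ ‖v‖ ≤ τ ∧ s = ‖u + v‖ / 2 + ‖u - v‖ / 2 - 1}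

theorem two_mul_modSmooth_ge {B : Type*} [NormedAddCommGroup B] {τ : ℝ} {u v : B}
    (hu : ‖u‖ ≤ 1) (hv : ‖v‖ ≤ τ) :
    ‖u + v‖ + ‖u - v‖ - 2 ≤ 2 * modSmooth B τ := by
  have hbdd : BddAbove {s : ℝ | ∃ u v : B, ‖u‖ ≤ 1 ∧ ‖v‖ ≤ τ ∧
      s = ‖u + v‖ / 2 + ‖u - v‖ / 2 - 1} := by
    refine ⟨τ, ?_⟩
    rintro s ⟨x, y, hx, hy, rfl⟩
    linarith [norm_add_le x y, norm_sub_le x y]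
  have h := le_csSup hbdd ⟨u, v, hu, hv, rfl⟩
  change _ ≤ modSmooth B τ at h
  linarith

/-- The real-linear estimate: support functionals at two distinct unit vectors are close. -/
theorem norm_sub_le_modSmooth_of_support {B : Type*} [NormedAddCommGroup B] [NormedSpace ℝ B]
    (f g : B →L[ℝ] ℝ) (hf : ∀ x, f x ≤ ‖x‖) (hg : ∀ x, g x ≤ ‖x‖) {a b : B}
    (ha : ‖a‖ = 1) (hb : ‖b‖ = 1) (hfa : f a = 1) (hgb : g b = 1) (hab : a ≠ b) :
    ‖f - g‖ ≤ 2 * modSmooth B (2 * ‖a - b‖) / ‖a - b‖ := by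
  have ht : 0 < ‖a - b‖ := norm_pos_iff.mpr (sub_ne_zero.mpr hab)
  have hgap : 1 - f b ≤ ‖f - g‖ * ‖a - b‖ := by
    have h1 := (le_abs_self _).trans ((f - g).le_opNorm (a - b))
    have h2 := hg a
    simp only [sub_apply, map_sub] at h1
    linarith
  have key : ∀ y : B, ‖y‖ ≤ 2 * ‖a - b‖ →
      (f - g) y ≤ 2 * modSmooth B (2 * ‖a - b‖) + ‖f - g‖ * ‖a - b‖ := by
    intro y hy
    have h1 := hf (b + y)
    have h2 := hg (b - y)
    have h3 := two_mul_modSmooth_ge hb.le hy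
    simp only [map_add, map_sub] at h1 h2
    simp only [sub_apply]
    linarith
  have h2t : 0 < 2 * ‖a - b‖ := by linarith
  have hC : 0 ≤ 2 * modSmooth B (2 * ‖a - b‖) + ‖f - g‖ * ‖a - b‖ := by
    simpa using key 0 (by simp)
  have hbound : ∀ x : B, (f - g) x ≤
      (2 * modSmooth B (2 * ‖a - b‖) + ‖f - g‖ * ‖a - b‖) / (2 * ‖a - b‖) * ‖x‖ := by
    intro x
    rcases eq_or_ne x 0 with rfl | hx
    · simp
    have hx' : 0 < ‖x‖ := norm_pos_iff.mpr hx
    have h := key ((2 * ‖a - b‖ / ‖x‖) • x) (by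
      rw [norm_smul, Real.norm_of_nonneg (by positivity), div_mul_cancel₀ _ hx'.ne'])
    rw [map_smul, smul_eq_mul, div_mul_eq_mul_div, div_le_iff₀ hx'] at h
    rw [div_mul_eq_mul_div, le_div_iff₀ h2t]
    linarith
  have hN := (f - g).opNorm_le_bound (div_nonneg hC h2t.le) fun x => by
    refine abs_le'.mpr ⟨hbound x, ?_⟩
    simpa only [map_neg, norm_neg] using hbound (-x)
  rw [le_div_iff₀ h2t] at hN
  rw [le_div_iff₀ ht]
  linarith

theorem stmt7 {𝕜 B : Type*} [RCLike 𝕜] [NormedAddCommGroup B] [NormedSpace 𝕜 B]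
    [NormedSpace ℝ B] [IsScalarTower ℝ 𝕜 B] [CompleteSpace B]
    -- `B` is uniformly smooth:
    (hus : Filter.Tendsto (fun τ => modSmooth B τ / τ) (𝓝[>] (0 : ℝ)) (𝓝 0))
    -- `j` is the duality map: `j v` is the unique support functional at each `v ≠ 0`:
    (j : B → (B →L[𝕜] 𝕜)) (hj0 : j 0 = 0)
    (hjn : ∀ v : B, v ≠ 0 → ‖j v‖ = 1)
    (hjv : ∀ v : B, v ≠ 0 → j v v = (‖v‖ : 𝕜))
    (hjuniq : ∀ v : B, v ≠ 0 → ∀ f : B →L[𝕜] 𝕜, ‖f‖ = 1 → f v = (‖v‖ : 𝕜) → f = j v)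
    (v u : B) (hv : v ≠ 0) (hu : u ≠ 0)
    (hvu : (‖v‖⁻¹ : ℝ) • v ≠ (‖u‖⁻¹ : ℝ) • u) :
    ‖(RCLike.reCLM (K := 𝕜)).comp ((j v).restrictScalars ℝ) -
        (RCLike.reCLM (K := 𝕜)).comp ((j u).restrictScalars ℝ)‖ ≤
      2 * modSmooth B (2 * ‖(‖v‖⁻¹ : ℝ) • v - (‖u‖⁻¹ : ℝ) • u‖) /
        ‖(‖v‖⁻¹ : ℝ) • v - (‖u‖⁻¹ : ℝ) • u‖ := by
  have hle : ∀ w : B, w ≠ 0 → ∀ x,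
      (RCLike.reCLM (K := 𝕜)).comp ((j w).restrictScalars ℝ) x ≤ ‖x‖ := by
    intro w hw x
    have h := (RCLike.re_le_norm (j w x)).trans ((j w).le_opNorm x)
    rw [hjn w hw, one_mul] at h
    exact h
  have hone : ∀ w : B, w ≠ 0 →
      (RCLike.reCLM (K := 𝕜)).comp ((j w).restrictScalars ℝ) ((‖w‖⁻¹ : ℝ) • w) = 1 := by
    intro w hw
    rw [map_smul]
    simp [hjv w hw, hw]
  have hunit : ∀ w : B, w ≠ 0 → ‖(‖w‖⁻¹ : ℝ) • w‖ = 1 := by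
    intro w hw
    simp [norm_smul, hw]
  exact norm_sub_le_modSmooth_of_support _ _ (hle v hv) (hle u hu) (hunit v hv) (hunit u hu)
    (hone v hv) (hone u hu) hvu
end

section
/- Let B be a strictly convex Banach space, let Γ be a group generated by a finite symmetric subset K with a weight m on K, let α be an affine isometric action of Γ on B, and let 1 ≤ r ≤ ∞. Then at every v ∈ B, |∇₋F_{α,r}|(v) = max{ sup_{u∈B, u≠v} (F_{α,r}(v) − F_{α,r}(u))/‖v − u‖, 0 }. -/
open Filter Topology

/-- Displacement function `F_{α,∞}(v) = max_{γ∈K} ‖α(γ)v - v‖`. -/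
noncomputable def dispInf {Γ B : Type*} [NormedAddCommGroup B] (K : Finset Γ)
    (hKne : K.Nonempty) (α : Γ → B → B) (v : B) : ℝ :=
  K.sup' hKne fun γ => ‖α γ v - v‖

/-- The absolute gradient of a convex Lipschitz function is given by its global slopes. -/
theorem absGrad_eq_of_convexOn {B : Type*} [NormedAddCommGroup B] [NormedSpace ℝ B]
    {F : B → ℝ} (hc : ConvexOn ℝ Set.univ F) {C : ℝ}
    (hL : ∀ v u, F v - F u ≤ C * ‖v - u‖) (v : B) :
    absGrad F v =
      max (sSup {s : ℝ | ∃ u : B, u ≠ v ∧ s = (F v - F u) / ‖v - u‖}) 0 := by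
  set S := {s : ℝ | ∃ u : B, u ≠ v ∧ s = (F v - F u) / ‖v - u‖} with hS
  have hpos : ∀ u, u ≠ v → 0 < ‖v - u‖ := fun u hu => norm_sub_pos_iff.2 hu.symm
  have hub : ∀ u, u ≠ v → (F v - F u) / ‖v - u‖ ≤ C := fun u hu =>
    (div_le_iff₀ (hpos u hu)).2 (hL v u)
  have hlb : ∀ u, u ≠ v → -C ≤ (F v - F u) / ‖v - u‖ := fun u hu => by
    rw [le_div_iff₀ (hpos u hu)]
    have := hL u v
    rw [norm_sub_rev] at this
    linarith
  have hbdd : BddAbove S := ⟨C, by rintro s ⟨u, hu, rfl⟩; exact hub u hu⟩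
  unfold absGrad
  congr 1
  rcases subsingleton_or_nontrivial B with hB | hB
  · have h1 : 𝓝[≠] v = ⊥ := by
      have : ({v}ᶜ : Set B) = ∅ := by ext x; simp [Subsingleton.elim x v]
      rw [this, nhdsWithin_empty]
    have h2 : S = ∅ := Set.eq_empty_of_forall_notMem fun s ⟨u, hu, _⟩ =>
      hu (Subsingleton.elim u v)
    rw [h1, h2, Real.sSup_empty]
    simp [limsup, limsSup]
  have : (𝓝[≠] v).NeBot := Module.punctured_nhds_neBot ℝ B v
  have hev : ∀ᶠ u in 𝓝[≠] v, u ≠ v := self_mem_nhdsWithin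
  apply le_antisymm
  · refine limsup_le_of_le ?_ (hev.mono fun u hu => le_csSup hbdd ⟨u, hu, rfl⟩)
    exact (isBoundedUnder_of_eventually_ge (hev.mono hlb)).isCoboundedUnder_flip
  · obtain ⟨w, hw⟩ := exists_ne v
    refine csSup_le ⟨_, w, hw, rfl⟩ ?_
    rintro s ⟨u, hu, rfl⟩
    refine le_limsup_of_frequently_le ?_ (isBoundedUnder_of_eventually_le (hev.mono hub))
    have htend : Tendsto (fun t : ℝ => v + t • (u - v)) (𝓝[>] 0) (𝓝[≠] v) := by
      refine tendsto_nhdsWithin_iff.2 ⟨?_, ?_⟩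
      · have : Continuous fun t : ℝ => v + t • (u - v) := by fun_prop
        simpa using (this.tendsto 0).mono_left nhdsWithin_le_nhds
      · filter_upwards [self_mem_nhdsWithin] with t ht
        simpa [sub_eq_zero, hu] using (ne_of_gt ht : t ≠ 0)
    refine htend.frequently (Eventually.frequently ?_)
    filter_upwards [Ioo_mem_nhdsGT (zero_lt_one' ℝ)] with t ht
    have hconv := hc.2 (Set.mem_univ v) (Set.mem_univ u) (sub_nonneg.2 ht.2.le) ht.1.le
      (by ring)
    have hpt : (1 - t) • v + t • u = v + t • (u - v) := by module
    rw [hpt, smul_eq_mul, smul_eq_mul] at hconv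
    have hn : ‖v - (v + t • (u - v))‖ = t * ‖v - u‖ := by
      rw [sub_add_cancel_left, norm_neg, norm_smul, Real.norm_of_nonneg ht.1.le,
        norm_sub_rev]
    rw [hn, div_le_div_iff₀ (hpos u hu) (mul_pos ht.1 (hpos u hu))]
    nlinarith [hpos u hu]

/-- Applying a normalized sublinear monotone functional to the displacements of affine
isometries gives a convex Lipschitz function. -/
theorem absGrad_eq_of_displacement {B Γ : Type*} [NormedAddCommGroup B] [NormedSpace ℝ B]
    (K : Finset Γ) (α : Γ → B ≃ᵃⁱ[ℝ] B) (N : (Γ → ℝ) → ℝ) (hN1 : N (fun _ => 1) = 1)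
    (hN : ∀ a b c : Γ → ℝ, ∀ s t : ℝ, 0 ≤ a → 0 ≤ b → 0 ≤ c → 0 ≤ s → 0 ≤ t →
      (∀ γ ∈ K, a γ ≤ s * b γ + t * c γ) → N a ≤ s * N b + t * N c) (v : B) :
    absGrad (fun w => N fun γ => ‖α γ w - w‖) v =
      max (sSup {s : ℝ | ∃ u : B, u ≠ v ∧ s =
        ((N fun γ => ‖α γ v - v‖) - N fun γ => ‖α γ u - u‖) / ‖v - u‖}) 0 := by
  have hnn : ∀ w, (0 : Γ → ℝ) ≤ fun γ => ‖α γ w - w‖ := fun w γ => norm_nonneg _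
  refine absGrad_eq_of_convexOn (F := fun w => N fun γ => ‖α γ w - w‖) (C := 2) ?_ ?_ v
  · refine ⟨convex_univ, fun x _ y _ s t hs ht hst => ?_⟩
    refine hN _ _ _ s t (hnn _) (hnn x) (hnn y) hs ht fun γ _ => ?_
    have h : α γ (s • x + t • y) = s • α γ x + t • α γ y :=
      Convex.combo_affine_apply (f := (α γ).toAffineEquiv.toAffineMap) hst
    have h2 : α γ (s • x + t • y) - (s • x + t • y) = s • (α γ x - x) + t • (α γ y - y) := by
      rw [h]; module
    rw [h2]
    refine (norm_add_le _ _).trans_eq ?_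
    rw [norm_smul, norm_smul, Real.norm_of_nonneg hs, Real.norm_of_nonneg ht]
  · intro x y
    have := hN _ _ (fun _ => 1) 1 (2 * ‖x - y‖) (hnn x) (hnn y) (fun _ => zero_le_one)
      zero_le_one (by positivity) fun γ _ => by
        have h : α γ x - x = (α γ y - y) + (α γ x - α γ y) + (y - x) := by abel
        have hd : ‖α γ x - α γ y‖ = ‖x - y‖ := by
          rw [← dist_eq_norm, (α γ).dist_map, dist_eq_norm]
        calc ‖α γ x - x‖ ≤ ‖α γ y - y‖ + ‖α γ x - α γ y‖ + ‖y - x‖ := by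
              rw [h]; exact norm_add₃_le
          _ = 1 * ‖α γ y - y‖ + 2 * ‖x - y‖ * 1 := by
              rw [hd, norm_sub_rev y x]; ring
    rw [hN1] at this
    linarith

/-- Weighted Minkowski inequality, together with monotonicity and homogeneity. -/
theorem weighted_Lp_le_combo {Γ : Type*} (K : Finset Γ) (m : Γ → ℝ) (hm : ∀ γ ∈ K, 0 ≤ m γ)
    {r : ℝ} (hr : 1 ≤ r) {a b c : Γ → ℝ} {s t : ℝ} (ha : 0 ≤ a) (hb : 0 ≤ b) (hc : 0 ≤ c)
    (hs : 0 ≤ s) (ht : 0 ≤ t) (h : ∀ γ ∈ K, a γ ≤ s * b γ + t * c γ) :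
    (∑ γ ∈ K, a γ ^ r * m γ) ^ (1 / r) ≤
      s * (∑ γ ∈ K, b γ ^ r * m γ) ^ (1 / r) + t * (∑ γ ∈ K, c γ ^ r * m γ) ^ (1 / r) := by
  have hr0 : 0 < r := by linarith
  have hw : ∀ γ ∈ K, 0 ≤ m γ ^ (1 / r) := fun γ hγ => Real.rpow_nonneg (hm γ hγ) _
  have hpow : ∀ γ ∈ K, ∀ x : ℝ, 0 ≤ x → (x * m γ ^ (1 / r)) ^ r = x ^ r * m γ := by
    intro γ hγ x hx
    rw [Real.mul_rpow hx (hw γ hγ), ← Real.rpow_mul (hm γ hγ), one_div_mul_cancel hr0.ne',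
      Real.rpow_one]
  have hhom : ∀ (d : Γ → ℝ) (q : ℝ), 0 ≤ d → 0 ≤ q →
      (∑ γ ∈ K, (q * d γ * m γ ^ (1 / r)) ^ r) ^ (1 / r) =
        q * (∑ γ ∈ K, d γ ^ r * m γ) ^ (1 / r) := by
    intro d q hd hq
    have : ∑ γ ∈ K, (q * d γ * m γ ^ (1 / r)) ^ r = q ^ r * ∑ γ ∈ K, d γ ^ r * m γ := by
      rw [Finset.mul_sum]
      refine Finset.sum_congr rfl fun γ hγ => ?_
      rw [hpow γ hγ _ (mul_nonneg hq (hd γ)), Real.mul_rpow hq (hd γ), mul_assoc]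
    rw [this, Real.mul_rpow (Real.rpow_nonneg hq _)
      (Finset.sum_nonneg fun γ hγ => mul_nonneg (Real.rpow_nonneg (hd γ) _) (hm γ hγ)),
      ← Real.rpow_mul hq, mul_one_div_cancel hr0.ne', Real.rpow_one]
  rw [← hhom b s hb hs, ← hhom c t hc ht]
  refine le_trans ?_ (Real.Lp_add_le_of_nonneg K hr
    (fun γ hγ => mul_nonneg (mul_nonneg hs (hb γ)) (hw γ hγ))
    (fun γ hγ => mul_nonneg (mul_nonneg ht (hc γ)) (hw γ hγ)))
  refine Real.rpow_le_rpow
    (Finset.sum_nonneg fun γ hγ => mul_nonneg (Real.rpow_nonneg (ha γ) _) (hm γ hγ))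
    (Finset.sum_le_sum fun γ hγ => ?_) (by positivity)
  rw [← hpow γ hγ _ (ha γ), ← add_mul]
  exact Real.rpow_le_rpow (mul_nonneg (ha γ) (hw γ hγ))
    (mul_le_mul_of_nonneg_right (h γ hγ) (hw γ hγ)) hr0.le

theorem stmt8 {B : Type*} [NormedAddCommGroup B] [NormedSpace ℝ B] [CompleteSpace B]
    -- `B` is strictly convex:
    (hB : ∀ v u : B, v ≠ u → ‖v‖ ≤ 1 → ‖u‖ ≤ 1 → ‖v + u‖ < 2)
    {Γ : Type*} [Group Γ] (K : Finset Γ) (hKne : K.Nonempty)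
    (hKsym : ∀ γ ∈ K, γ⁻¹ ∈ K)
    (hKgen : Subgroup.closure (K : Set Γ) = ⊤)
    (m : Γ → ℝ) (hmpos : ∀ γ ∈ K, 0 < m γ) (hmsum : ∑ γ ∈ K, m γ = 1)
    -- `α` is an affine isometric action of `Γ` on `B`:
    (α : Γ →* (B ≃ᵃⁱ[ℝ] B))
    -- `F = F_{α,r}` for some `1 ≤ r < ∞`, or `F = F_{α,∞}`:
    (F : B → ℝ)
    (hF : (∃ r : ℝ, 1 ≤ r ∧ F = dispR K m (fun γ w => α γ w) r) ∨
      F = dispInf K hKne (fun γ w => α γ w))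
    (v : B) :
    absGrad F v =
      max (sSup {s : ℝ | ∃ u : B, u ≠ v ∧ s = (F v - F u) / ‖v - u‖}) 0 := by
  rcases hF with ⟨r, hr, rfl⟩ | rfl
  · refine absGrad_eq_of_displacement K α (fun a => (∑ γ ∈ K, a γ ^ r * m γ) ^ (1 / r)) ?_ ?_ v
    · simp [hmsum]
    · intro a b c s t ha hb hc hs ht h
      exact weighted_Lp_le_combo K m (fun γ hγ => (hmpos γ hγ).le) hr ha hb hc hs ht h
  · refine absGrad_eq_of_displacement K α (fun a => K.sup' hKne a) ?_ ?_ v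
    · exact Finset.sup'_const hKne 1
    · intro a b c s t _ _ _ hs ht h
      refine Finset.sup'_le hKne a fun γ hγ => (h γ hγ).trans ?_
      gcongr
      · exact Finset.le_sup' b hγ
      · exact Finset.le_sup' c hγ
end

section
/- Let B be a strictly convex Banach space, let Γ be a group generated by a finite symmetric subset K with a weight m on K, let α be an affine isometric action of Γ on B, and let 1 ≤ r ≤ ∞. Then a point v₀ ∈ B minimizes F_{α,r} (i.e. F_{α,r}(v₀) ≤ F_{α,r}(u) for all u ∈ B) if and only if |∇₋F_{α,r}|(v₀) = 0. -/
open Filter Topology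

section AbsGrad

variable {B : Type*} [NormedAddCommGroup B]

/-- The difference quotients of a function with linear growth control are bounded. -/
lemma abs_slope_le_of_sub_le {F : B → ℝ} {C : ℝ} (hL : ∀ u v, F v - F u ≤ C * ‖v - u‖)
    {u v : B} (huv : u ≠ v) : |(F v - F u) / ‖v - u‖| ≤ C := by
  have hpos : 0 < ‖v - u‖ := norm_pos_iff.2 (sub_ne_zero.2 huv.symm)
  rw [abs_div, abs_of_pos hpos, div_le_iff₀ hpos, abs_le]
  have h := hL v u
  rw [norm_sub_rev] at h
  exact ⟨by linarith, hL u v⟩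

/-- A convex Lipschitz function is minimal exactly where its absolute gradient vanishes. -/
lemma ConvexOn.forall_le_iff_absGrad_eq_zero [NormedSpace ℝ B] {F : B → ℝ}
    (hF : ConvexOn ℝ Set.univ F) {C : ℝ} (hL : ∀ u v, F v - F u ≤ C * ‖v - u‖) (v₀ : B) :
    (∀ u, F v₀ ≤ F u) ↔ absGrad F v₀ = 0 := by
  have hbdd : ∀ᶠ u in 𝓝[≠] v₀, |(F v₀ - F u) / ‖v₀ - u‖| ≤ C :=
    eventually_mem_nhdsWithin.mono fun u hu => abs_slope_le_of_sub_le hL hu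
  have hub : IsBoundedUnder (· ≤ ·) (𝓝[≠] v₀) fun u => (F v₀ - F u) / ‖v₀ - u‖ :=
    isBoundedUnder_of_eventually_le (hbdd.mono fun u hu => (abs_le.1 hu).2)
  have hlb : IsBoundedUnder (· ≥ ·) (𝓝[≠] v₀) fun u => (F v₀ - F u) / ‖v₀ - u‖ :=
    isBoundedUnder_of_eventually_ge (hbdd.mono fun u hu => (abs_le.1 hu).1)
  constructor
  · intro hmin
    refine max_eq_right ?_
    rcases eq_or_neBot (𝓝[≠] v₀) with hbot | hne
    · simp [hbot, limsup, limsSup]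
    · exact limsup_le_of_le hlb.isCoboundedUnder_le
        (Eventually.of_forall fun u =>
          div_nonpos_of_nonpos_of_nonneg (sub_nonpos.2 (hmin u)) (norm_nonneg _))
  · intro hgrad u
    by_contra! hu
    have hne : v₀ - u ≠ 0 := by
      intro h
      rw [sub_eq_zero.1 h] at hu
      exact lt_irrefl _ hu
    have hpos : 0 < ‖v₀ - u‖ := norm_pos_iff.2 hne
    have htend : Tendsto (fun t : ℝ => (1 - t) • v₀ + t • u) (𝓝[>] 0) (𝓝[≠] v₀) := by
      refine tendsto_nhdsWithin_iff.2 ⟨?_, ?_⟩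
      · have hcont : Continuous fun t : ℝ => (1 - t) • v₀ + t • u := by fun_prop
        simpa using (hcont.tendsto 0).mono_left nhdsWithin_le_nhds
      · filter_upwards [self_mem_nhdsWithin] with t ht heq
        have h0 : t • (v₀ - u) = 0 := by
          have h1 : t • (v₀ - u) = v₀ - ((1 - t) • v₀ + t • u) := by module
          rw [h1, Set.mem_singleton_iff.1 heq, sub_self]
        exact (smul_ne_zero (ne_of_gt ht) hne) h0
    have hfreq : ∃ᶠ w in 𝓝[≠] v₀,
        (F v₀ - F u) / ‖v₀ - u‖ ≤ (F v₀ - F w) / ‖v₀ - w‖ := by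
      refine htend.frequently (Eventually.frequently ?_)
      filter_upwards [Ioo_mem_nhdsGT (zero_lt_one' ℝ)] with t ht
      have hconv := hF.2 (Set.mem_univ v₀) (Set.mem_univ u) (sub_nonneg.2 ht.2.le) ht.1.le
        (sub_add_cancel 1 t)
      simp only [smul_eq_mul] at hconv
      have h1 : v₀ - ((1 - t) • v₀ + t • u) = t • (v₀ - u) := by module
      rw [h1, norm_smul, Real.norm_of_nonneg ht.1.le, div_le_div_iff₀ hpos (mul_pos ht.1 hpos)]
      nlinarith
    have hle := le_limsup_of_frequently_le hfreq hub
    have hmax : limsup (fun w => (F v₀ - F w) / ‖v₀ - w‖) (𝓝[≠] v₀) ≤ 0 :=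
      (le_max_left _ _).trans hgrad.le
    exact absurd (hle.trans hmax) (not_le.2 (div_pos (sub_pos.2 hu) hpos))

end AbsGrad

section Displacement

variable {Γ B : Type*} [NormedAddCommGroup B] [NormedSpace ℝ B]

/-- A monotone sublinear function of the displacements of affine isometries is minimal exactly
where its absolute gradient vanishes. -/
lemma forall_le_iff_absGrad_eq_zero_of_sublinear (α : Γ → B ≃ᵃⁱ[ℝ] B) (N : (Γ → ℝ) → ℝ)
    (hmono : ∀ x y, 0 ≤ x → x ≤ y → N x ≤ N y)
    (hadd : ∀ x y, 0 ≤ x → 0 ≤ y → N (x + y) ≤ N x + N y)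
    (hsmul : ∀ (c : ℝ) (x), 0 ≤ c → 0 ≤ x → N (c • x) = c * N x) (v₀ : B) :
    (∀ u, N (fun γ => ‖α γ v₀ - v₀‖) ≤ N (fun γ => ‖α γ u - u‖)) ↔
      absGrad (fun v => N fun γ => ‖α γ v - v‖) v₀ = 0 := by
  have hnn : ∀ v : B, (0 : Γ → ℝ) ≤ fun γ => ‖α γ v - v‖ := fun v γ => norm_nonneg _
  refine ConvexOn.forall_le_iff_absGrad_eq_zero (F := fun v => N fun γ => ‖α γ v - v‖)
    (C := 2 * N 1) ⟨convex_univ, ?_⟩ ?_ v₀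
  · intro u _ v _ a b ha hb hab
    simp only [smul_eq_mul]
    rw [← hsmul a _ ha (hnn u), ← hsmul b _ hb (hnn v)]
    refine (hmono _ _ (hnn _) fun γ => ?_).trans
      (hadd _ _ (smul_nonneg ha (hnn u)) (smul_nonneg hb (hnn v)))
    have hcomb : α γ (a • u + b • v) = a • α γ u + b • α γ v :=
      Convex.combo_affine_apply (f := (α γ).toAffineEquiv.toAffineMap) hab
    have hdisp : α γ (a • u + b • v) - (a • u + b • v)
        = a • (α γ u - u) + b • (α γ v - v) := by
      rw [hcomb]; module
    simp only [hdisp, Pi.add_apply, Pi.smul_apply, smul_eq_mul]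
    refine (norm_add_le _ _).trans_eq ?_
    rw [norm_smul, norm_smul, Real.norm_of_nonneg ha, Real.norm_of_nonneg hb]
  · intro u v
    have hc : 0 ≤ 2 * ‖v - u‖ := by positivity
    have hle : (fun γ => ‖α γ v - v‖) ≤ (fun γ => ‖α γ u - u‖) + (2 * ‖v - u‖) • 1 := by
      intro γ
      have hiso : ‖α γ v - α γ u‖ = ‖v - u‖ := by
        rw [← dist_eq_norm, (α γ).dist_map, dist_eq_norm]
      have heq : α γ v - v = (α γ u - u) + ((α γ v - α γ u) - (v - u)) := by abel
      simp only [Pi.add_apply, Pi.smul_apply, Pi.one_apply, smul_eq_mul, mul_one]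
      rw [heq]
      refine (norm_add_le _ _).trans (add_le_add_right ((norm_sub_le _ _).trans ?_) _)
      rw [hiso, two_mul]
    have h := (hmono _ _ (hnn v) hle).trans
      (hadd _ _ (hnn u) (smul_nonneg hc zero_le_one))
    rw [hsmul _ _ hc zero_le_one] at h
    linarith

end Displacement

section WeightedNorm

variable {Γ : Type*} (K : Finset Γ) (m : Γ → ℝ)

lemma weighted_Lp_mono (hm : ∀ γ ∈ K, 0 < m γ) {r : ℝ} (hr : 1 ≤ r) {x y : Γ → ℝ}
    (hx : 0 ≤ x) (hxy : x ≤ y) :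
    (∑ γ ∈ K, x γ ^ r * m γ) ^ (1 / r) ≤ (∑ γ ∈ K, y γ ^ r * m γ) ^ (1 / r) := by
  refine Real.rpow_le_rpow ?_ (Finset.sum_le_sum fun γ hγ => ?_) (by positivity)
  · exact Finset.sum_nonneg fun γ hγ => mul_nonneg (Real.rpow_nonneg (hx γ) _) (hm γ hγ).le
  · exact mul_le_mul_of_nonneg_right (Real.rpow_le_rpow (hx γ) (hxy γ) (by linarith)) (hm γ hγ).le

lemma weighted_Lp_add_le (hm : ∀ γ ∈ K, 0 < m γ) {r : ℝ} (hr : 1 ≤ r) {x y : Γ → ℝ}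
    (hx : 0 ≤ x) (hy : 0 ≤ y) :
    (∑ γ ∈ K, (x + y) γ ^ r * m γ) ^ (1 / r) ≤
      (∑ γ ∈ K, x γ ^ r * m γ) ^ (1 / r) + (∑ γ ∈ K, y γ ^ r * m γ) ^ (1 / r) := by
  have hr0 : r ≠ 0 := by linarith
  have hw : ∀ z : Γ → ℝ, 0 ≤ z →
      ∑ γ ∈ K, z γ ^ r * m γ = ∑ γ ∈ K, (z γ * m γ ^ (1 / r)) ^ r := by
    intro z hz
    refine Finset.sum_congr rfl fun γ hγ => ?_
    rw [Real.mul_rpow (hz γ) (Real.rpow_nonneg (hm γ hγ).le _), ← Real.rpow_mul (hm γ hγ).le,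
      one_div_mul_cancel hr0, Real.rpow_one]
  rw [hw x hx, hw y hy, hw (x + y) (add_nonneg hx hy)]
  simp only [Pi.add_apply, add_mul]
  exact Real.Lp_add_le_of_nonneg K hr
    (fun γ hγ => mul_nonneg (hx γ) (Real.rpow_nonneg (hm γ hγ).le _))
    (fun γ hγ => mul_nonneg (hy γ) (Real.rpow_nonneg (hm γ hγ).le _))

lemma weighted_Lp_smul (hm : ∀ γ ∈ K, 0 < m γ) {r : ℝ} (hr : 1 ≤ r) {c : ℝ} {x : Γ → ℝ}
    (hc : 0 ≤ c) (hx : 0 ≤ x) :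
    (∑ γ ∈ K, (c • x) γ ^ r * m γ) ^ (1 / r) = c * (∑ γ ∈ K, x γ ^ r * m γ) ^ (1 / r) := by
  have hr0 : r ≠ 0 := by linarith
  have hsum : ∑ γ ∈ K, (c • x) γ ^ r * m γ = c ^ r * ∑ γ ∈ K, x γ ^ r * m γ := by
    rw [Finset.mul_sum]
    refine Finset.sum_congr rfl fun γ _ => ?_
    rw [Pi.smul_apply, smul_eq_mul, Real.mul_rpow hc (hx γ), mul_assoc]
  rw [hsum, Real.mul_rpow (Real.rpow_nonneg hc _) (Finset.sum_nonneg fun γ hγ =>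
    mul_nonneg (Real.rpow_nonneg (hx γ) _) (hm γ hγ).le), ← Real.rpow_mul hc,
    mul_one_div_cancel hr0, Real.rpow_one]

end WeightedNorm

theorem stmt9 {B : Type*} [NormedAddCommGroup B] [NormedSpace ℝ B] [CompleteSpace B]
    -- `B` is strictly convex:
    (hB : ∀ v u : B, v ≠ u → ‖v‖ ≤ 1 → ‖u‖ ≤ 1 → ‖v + u‖ < 2)
    {Γ : Type*} [Group Γ] (K : Finset Γ) (hKne : K.Nonempty)
    (hKsym : ∀ γ ∈ K, γ⁻¹ ∈ K)
    (hKgen : Subgroup.closure (K : Set Γ) = ⊤)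
    (m : Γ → ℝ) (hmpos : ∀ γ ∈ K, 0 < m γ) (hmsum : ∑ γ ∈ K, m γ = 1)
    -- `α` is an affine isometric action of `Γ` on `B`:
    (α : Γ →* (B ≃ᵃⁱ[ℝ] B))
    -- `F = F_{α,r}` for some `1 ≤ r < ∞`, or `F = F_{α,∞}`:
    (F : B → ℝ)
    (hF : (∃ r : ℝ, 1 ≤ r ∧ F = dispR K m (fun γ w => α γ w) r) ∨
      F = dispInf K hKne (fun γ w => α γ w))
    (v₀ : B) :
    (∀ u : B, F v₀ ≤ F u) ↔ absGrad F v₀ = 0 := by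
  rcases hF with ⟨r, hr, rfl⟩ | rfl
  · exact forall_le_iff_absGrad_eq_zero_of_sublinear α
      (fun x => (∑ γ ∈ K, x γ ^ r * m γ) ^ (1 / r))
      (fun _ _ => weighted_Lp_mono K m hmpos hr)
      (fun _ _ => weighted_Lp_add_le K m hmpos hr)
      (fun _ _ => weighted_Lp_smul K m hmpos hr) v₀
  · refine forall_le_iff_absGrad_eq_zero_of_sublinear α (fun x => K.sup' hKne x)
      (fun x y _ hxy => Finset.sup'_mono_fun fun γ _ => hxy γ)
      (fun x y _ _ => Finset.sup'_le _ _ fun γ hγ =>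
        add_le_add (Finset.le_sup' x hγ) (Finset.le_sup' y hγ))
      (fun c x hc _ => ?_) v₀
    exact (Finset.mul₀_sup' hc x K hKne).symm
end

section
/- Let B be a strictly convex Banach space, let Γ be a group generated by a finite symmetric subset K with a weight m on K, let α be an affine isometric action of Γ on B, and let 1 ≤ r ≤ ∞. Then the function v ↦ |∇₋F_{α,r}|(v) is lower semicontinuous on B. -/
open Filter Topology

/-- The properties of a seminorm, required only on nonnegative functions, together with
monotonicity there. -/
structure IsMonotoneGauge {ι : Type*} (N : (ι → ℝ) → ℝ) : Prop where
  mono : ∀ f g : ι → ℝ, 0 ≤ f → f ≤ g → N f ≤ N g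
  add_le : ∀ f g : ι → ℝ, 0 ≤ f → 0 ≤ g → N (f + g) ≤ N f + N g
  smul : ∀ (c : ℝ) (f : ι → ℝ), 0 ≤ c → 0 ≤ f → N (c • f) = c * N f

lemma isMonotoneGauge_weightedLp {ι : Type*} (K : Finset ι) (m : ι → ℝ)
    (hm : ∀ i ∈ K, 0 < m i) {r : ℝ} (hr : 1 ≤ r) :
    IsMonotoneGauge fun f : ι → ℝ => (∑ i ∈ K, f i ^ r * m i) ^ (1 / r) where
  mono f g hf hfg := by
    have hsum : 0 ≤ ∑ i ∈ K, f i ^ r * m i := Finset.sum_nonneg fun i hi =>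
      mul_nonneg (Real.rpow_nonneg (hf i) _) (hm i hi).le
    refine Real.rpow_le_rpow hsum (Finset.sum_le_sum fun i hi => ?_) (by positivity)
    exact mul_le_mul_of_nonneg_right
      (Real.rpow_le_rpow (hf i) (hfg i) (by linarith)) (hm i hi).le
  add_le f g hf hg := by
    have key : ∀ h : ι → ℝ, 0 ≤ h → ∑ i ∈ K, h i ^ r * m i
        = ∑ i ∈ K, (h i * m i ^ (1 / r)) ^ r := fun h hh =>
      Finset.sum_congr rfl fun i hi => by
        rw [Real.mul_rpow (hh i) (Real.rpow_nonneg (hm i hi).le _),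
          ← Real.rpow_mul (hm i hi).le, one_div_mul_cancel (by linarith), Real.rpow_one]
    rw [key f hf, key g hg, key (f + g) (add_nonneg hf hg)]
    simp only [Pi.add_apply, add_mul]
    exact Real.Lp_add_le_of_nonneg K hr
      (fun i hi => mul_nonneg (hf i) (Real.rpow_nonneg (hm i hi).le _))
      (fun i hi => mul_nonneg (hg i) (Real.rpow_nonneg (hm i hi).le _))
  smul c f hc hf := by
    have hsum : 0 ≤ ∑ i ∈ K, f i ^ r * m i := Finset.sum_nonneg fun i hi =>
      mul_nonneg (Real.rpow_nonneg (hf i) _) (hm i hi).le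
    have : ∑ i ∈ K, (c • f) i ^ r * m i = c ^ r * ∑ i ∈ K, f i ^ r * m i := by
      rw [Finset.mul_sum]
      refine Finset.sum_congr rfl fun i _ => ?_
      rw [Pi.smul_apply, smul_eq_mul, Real.mul_rpow hc (hf i), mul_assoc]
    simp only [this]
    rw [Real.mul_rpow (Real.rpow_nonneg hc _) hsum, ← Real.rpow_mul hc,
      mul_one_div_cancel (by linarith), Real.rpow_one]

lemma isMonotoneGauge_sup' {ι : Type*} (K : Finset ι) (hK : K.Nonempty) :
    IsMonotoneGauge fun f : ι → ℝ => K.sup' hK f where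
  mono _ _ _ hfg := Finset.sup'_mono_fun fun i _ => hfg i
  add_le f g _ _ := Finset.sup'_le _ _ fun _ hi =>
    add_le_add (Finset.le_sup' f hi) (Finset.le_sup' g hi)
  smul _ f hc _ := (Finset.mul₀_sup' hc f K hK).symm

section Displacement

variable {B ι : Type*} [NormedAddCommGroup B] [NormedSpace ℝ B] {N : (ι → ℝ) → ℝ}

lemma IsMonotoneGauge.convexOn_displacement (hN : IsMonotoneGauge N) (a : ι → B →ᵃⁱ[ℝ] B) :
    ConvexOn ℝ Set.univ fun v => N fun i => ‖a i v - v‖ := by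
  refine ⟨convex_univ, fun v _ u _ s t hs ht hst => ?_⟩
  have hf : (0 : ι → ℝ) ≤ fun i => ‖a i v - v‖ := fun i => norm_nonneg _
  have hg : (0 : ι → ℝ) ≤ fun i => ‖a i u - u‖ := fun i => norm_nonneg _
  simp only [smul_eq_mul]
  rw [← hN.smul s _ hs hf, ← hN.smul t _ ht hg]
  refine (hN.mono _ _ (fun i => norm_nonneg _) fun i => ?_).trans
    (hN.add_le _ _ (smul_nonneg hs hf) (smul_nonneg ht hg))
  have h : a i (s • v + t • u) = s • a i v + t • a i u :=
    Convex.combo_affine_apply (f := (a i).toAffineMap) hst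
  calc ‖a i (s • v + t • u) - (s • v + t • u)‖
      = ‖s • (a i v - v) + t • (a i u - u)‖ := by
        rw [h]; congr 1; module
    _ ≤ ‖s • (a i v - v)‖ + ‖t • (a i u - u)‖ := norm_add_le _ _
    _ = s * ‖a i v - v‖ + t * ‖a i u - u‖ := by
        rw [norm_smul, norm_smul, Real.norm_of_nonneg hs, Real.norm_of_nonneg ht]

lemma IsMonotoneGauge.displacement_sub_le (hN : IsMonotoneGauge N) (a : ι → B →ᵃⁱ[ℝ] B)
    (v u : B) :
    (N fun i => ‖a i v - v‖) - (N fun i => ‖a i u - u‖) ≤ 2 * N 1 * ‖v - u‖ := by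
  have hg : (0 : ι → ℝ) ≤ fun i => ‖a i u - u‖ := fun i => norm_nonneg _
  have hc : 0 ≤ 2 * ‖v - u‖ := by positivity
  have h1 : (0 : ι → ℝ) ≤ 1 := zero_le_one
  have := (hN.mono (fun i => ‖a i v - v‖) ((fun i => ‖a i u - u‖) + (2 * ‖v - u‖) • 1)
    (fun i => norm_nonneg _) fun i => ?_).trans (hN.add_le _ _ hg (smul_nonneg hc h1))
  · rw [hN.smul _ _ hc h1] at this
    linarith
  · have h : ‖a i v - a i u‖ = ‖v - u‖ := by
      rw [← dist_eq_norm, (a i).isometry.dist_eq, dist_eq_norm]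
    have e : a i v - v = (a i u - u) + ((a i v - a i u) - (v - u)) := by abel
    have := norm_add_le (a i u - u) ((a i v - a i u) - (v - u))
    have := norm_sub_le (a i v - a i u) (v - u)
    simp only [Pi.add_apply, Pi.smul_apply, Pi.one_apply, smul_eq_mul, mul_one]
    rw [e]
    linarith

end Displacement

/-- For a convex function the absolute gradient dominates every descent slope. -/
lemma ConvexOn.slope_le_absGrad {B : Type*} [NormedAddCommGroup B] [NormedSpace ℝ B]
    {F : B → ℝ} (hF : ConvexOn ℝ Set.univ F) {L : ℝ}
    (hL : ∀ v u, F v - F u ≤ L * ‖v - u‖) {v u : B} (huv : u ≠ v) :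
    (F v - F u) / ‖v - u‖ ≤ absGrad F v := by
  refine le_max_of_le_left (le_limsup_of_frequently_le ?_ ?_)
  · have htend : Tendsto (fun t : ℝ => v + t • (u - v)) (𝓝[>] 0) (𝓝[≠] v) := by
      refine tendsto_nhdsWithin_iff.2 ⟨?_, ?_⟩
      · have : Continuous fun t : ℝ => v + t • (u - v) := by fun_prop
        simpa using (this.tendsto 0).mono_left nhdsWithin_le_nhds
      · filter_upwards [self_mem_nhdsWithin] with t ht
        simpa [sub_eq_zero, huv] using (ne_of_gt ht : t ≠ 0)
    refine htend.frequently (Eventually.frequently ?_)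
    filter_upwards [Ioc_mem_nhdsGT (zero_lt_one' ℝ)] with t ht
    have hn : 0 < ‖v - u‖ := norm_pos_iff.2 (sub_ne_zero.2 huv.symm)
    have hconv := hF.2 (Set.mem_univ v) (Set.mem_univ u) (sub_nonneg.2 ht.2) ht.1.le (by ring)
    rw [show (1 - t) • v + t • u = v + t • (u - v) by module, smul_eq_mul, smul_eq_mul] at hconv
    have hnorm : ‖v - (v + t • (u - v))‖ = t * ‖v - u‖ := by
      rw [show v - (v + t • (u - v)) = t • (v - u) by module, norm_smul,
        Real.norm_of_nonneg ht.1.le]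
    rw [hnorm, div_le_div_iff₀ hn (mul_pos ht.1 hn)]
    nlinarith
  · refine isBoundedUnder_of_eventually_le (a := L) ?_
    filter_upwards [self_mem_nhdsWithin] with w hw
    exact (div_le_iff₀ (norm_pos_iff.2 (sub_ne_zero.2 (Ne.symm hw)))).2 (hL v w)

lemma ConvexOn.lowerSemicontinuous_absGrad {B : Type*} [NormedAddCommGroup B]
    [NormedSpace ℝ B] {F : B → ℝ} (hF : ConvexOn ℝ Set.univ F) {L : ℝ}
    (hL : ∀ v u, F v - F u ≤ L * ‖v - u‖) : LowerSemicontinuous (absGrad F) := by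
  intro v c hc
  rcases lt_or_ge c 0 with hc0 | hc0
  · exact Eventually.of_forall fun w => hc0.trans_le (le_max_right _ _)
  rcases subsingleton_or_nontrivial B with hB | hB
  · exact Eventually.of_forall fun w => Subsingleton.elim v w ▸ hc
  have hlim : c < limsup (fun u => (F v - F u) / ‖v - u‖) (𝓝[≠] v) :=
    (lt_max_iff.1 hc).resolve_right hc0.not_gt
  have hcob : IsCoboundedUnder (· ≤ ·) (𝓝[≠] v) fun u => (F v - F u) / ‖v - u‖ := by
    refine IsBoundedUnder.isCoboundedUnder_le (isBoundedUnder_of_eventually_ge (a := -L) ?_)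
    filter_upwards [self_mem_nhdsWithin] with w hw
    rw [le_div_iff₀ (norm_pos_iff.2 (sub_ne_zero.2 (Ne.symm hw)))]
    have := hL w v
    rw [norm_sub_rev] at this
    linarith
  obtain ⟨u, hu, huv⟩ :=
    ((frequently_lt_of_lt_limsup hcob hlim).and_eventually self_mem_nhdsWithin).exists
  have huv : u ≠ v := huv
  have hcont : Continuous F := by
    refine (LipschitzWith.of_le_add_mul' L fun x y => ?_).continuous
    rw [dist_eq_norm]
    linarith [hL x y]
  have hq : ContinuousAt (fun w => (F w - F u) / ‖w - u‖) v :=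
    ContinuousAt.div (by fun_prop) (by fun_prop) (norm_ne_zero_iff.2 (sub_ne_zero.2 huv.symm))
  filter_upwards [hq.eventually (lt_mem_nhds hu), isOpen_ne.mem_nhds huv.symm] with w hw hwu
  exact hw.trans_le (hF.slope_le_absGrad hL (Ne.symm hwu))

theorem stmt10 {B : Type*} [NormedAddCommGroup B] [NormedSpace ℝ B] [CompleteSpace B]
    -- `B` is strictly convex:
    (hB : ∀ v u : B, v ≠ u → ‖v‖ ≤ 1 → ‖u‖ ≤ 1 → ‖v + u‖ < 2)
    {Γ : Type*} [Group Γ] (K : Finset Γ) (hKne : K.Nonempty)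
    (hKsym : ∀ γ ∈ K, γ⁻¹ ∈ K)
    (hKgen : Subgroup.closure (K : Set Γ) = ⊤)
    (m : Γ → ℝ) (hmpos : ∀ γ ∈ K, 0 < m γ) (hmsum : ∑ γ ∈ K, m γ = 1)
    -- `α` is an affine isometric action of `Γ` on `B`:
    (α : Γ →* (B ≃ᵃⁱ[ℝ] B))
    -- `F = F_{α,r}` for some `1 ≤ r < ∞`, or `F = F_{α,∞}`:
    (F : B → ℝ)
    (hF : (∃ r : ℝ, 1 ≤ r ∧ F = dispR K m (fun γ w => α γ w) r) ∨
      F = dispInf K hKne (fun γ w => α γ w)) :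
    LowerSemicontinuous (fun v : B => absGrad F v) := by
  have of_gauge : ∀ N : (Γ → ℝ) → ℝ, IsMonotoneGauge N →
      LowerSemicontinuous (absGrad fun v => N fun γ => ‖α γ v - v‖) := fun N hN =>
    (hN.convexOn_displacement fun γ => (α γ).toAffineIsometry).lowerSemicontinuous_absGrad
      (hN.displacement_sub_le fun γ => (α γ).toAffineIsometry)
  rcases hF with ⟨r, hr, rfl⟩ | rfl
  · exact of_gauge (fun f => (∑ γ ∈ K, f γ ^ r * m γ) ^ (1 / r))
      (isMonotoneGauge_weightedLp K m hmpos hr)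
  · exact of_gauge (fun f => K.sup' hKne f) (isMonotoneGauge_sup' K hKne)
end

section
/- Let B be a real Banach space that is strictly convex and smooth, with duality map j. Let Γ be a group generated by a finite symmetric subset K with a symmetric weight m on K, let α be an affine isometric action of Γ on B with linear part π, and let 1 < p < ∞. Then for every v ∈ B with F_{α,p}(v) > 0: |∇₋F_{α,p}|(v) = (1/F_{α,p}(v)^{p−1}) · sup_{u∈B, ‖u‖=1} Σ_{γ∈K} ‖α(γ)v − v‖^{p−1} · j(α(γ)v − v)(π(γ)u − u) · m(γ) = (2/F_{α,p}(v)^{p−1}) · ‖ Σ_{γ∈K} ‖α(γ)v − v‖^{p−1} m(γ) j(α(γ)v − v) ‖_{B*}. -/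
open Filter Topology

theorem limsup_slope_eq_opNorm {B : Type*} [NormedAddCommGroup B] [NormedSpace ℝ B]
    [Nontrivial B] (F : B → ℝ) (φ : B → (B →L[ℝ] ℝ)) (v : B)
    (hsub : ∀ᶠ u in 𝓝 v, ∀ w, F u + φ u (w - u) ≤ F w)
    (hφ : ∀ y, Tendsto (fun u => φ u y) (𝓝 v) (𝓝 (φ v y))) :
    Filter.limsup (fun u => (F v - F u) / ‖v - u‖) (𝓝[≠] v) = ‖φ v‖ := by
  have hupper : ∀ᶠ u in 𝓝[≠] v, (F v - F u) / ‖v - u‖ ≤ ‖φ v‖ := by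
    filter_upwards [self_mem_nhdsWithin] with u hu
    have hpos : 0 < ‖v - u‖ := norm_pos_iff.2 (sub_ne_zero.2 (Ne.symm hu))
    rw [div_le_iff₀ hpos]
    have h1 := hsub.self_of_nhds u
    have h2 := (le_abs_self _).trans ((φ v).le_opNorm (v - u))
    have h3 : φ v (v - u) = - φ v (u - v) := by rw [← map_neg, neg_sub]
    linarith
  have hlower : ∀ a : ℝ, (∀ᶠ u in 𝓝[≠] v, (F v - F u) / ‖v - u‖ ≤ a) → ‖φ v‖ ≤ a := by
    intro a ha
    have hdir : ∀ y : B, ‖y‖ = 1 → - φ v y ≤ a := by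
      intro y hy
      have hy0 : y ≠ 0 := by rintro rfl; simp at hy
      have hray : Tendsto (fun t : ℝ => v + t • y) (𝓝[>] 0) (𝓝 v) := by
        have : Continuous fun t : ℝ => v + t • y := by fun_prop
        simpa using (this.tendsto 0).mono_left nhdsWithin_le_nhds
      have hray' : Tendsto (fun t : ℝ => v + t • y) (𝓝[>] 0) (𝓝[≠] v) := by
        refine tendsto_nhdsWithin_iff.2 ⟨hray, ?_⟩
        filter_upwards [self_mem_nhdsWithin] with t ht
        simpa [hy0] using (Set.mem_Ioi.1 ht).ne'
      refine le_of_tendsto ((hφ y).comp hray).neg ?_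
      filter_upwards [self_mem_nhdsWithin, hray.eventually hsub, hray'.eventually ha]
        with t ht h1 h2
      have ht : 0 < t := ht
      refine le_trans ?_ h2
      have h3 := h1 v
      simp only [sub_add_cancel_left, map_neg, map_smul, smul_eq_mul, norm_neg, norm_smul, hy,
        mul_one, Real.norm_eq_abs, abs_of_pos ht, Function.comp_apply] at h3 ⊢
      rw [le_div_iff₀ ht]
      linarith
    obtain ⟨y₀, hy₀⟩ := exists_norm_eq B zero_le_one
    have ha0 : 0 ≤ a := by
      have h1 := hdir y₀ hy₀
      have h2 := hdir (-y₀) (by simpa using hy₀)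
      rw [map_neg] at h2
      linarith
    refine (φ v).opNorm_le_of_unit_norm ha0 fun y hy => ?_
    rw [Real.norm_eq_abs, abs_le']
    constructor
    · simpa using hdir (-y) (by simpa using hy)
    · exact hdir y hy
  rw [Filter.limsup_eq]
  exact le_antisymm (csInf_le ⟨_, fun a ha => hlower a ha⟩ hupper)
    (le_csInf ⟨_, hupper⟩ fun a ha => hlower a ha)

theorem sSup_image_unit_eq_opNorm {B : Type*} [NormedAddCommGroup B] [NormedSpace ℝ B]
    [Nontrivial B] (f : B →L[ℝ] ℝ) : sSup {s : ℝ | ∃ u : B, ‖u‖ = 1 ∧ s = f u} = ‖f‖ := by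
  have hle : ∀ s ∈ {s : ℝ | ∃ u : B, ‖u‖ = 1 ∧ s = f u}, s ≤ ‖f‖ := by
    rintro s ⟨u, hu, rfl⟩
    simpa [hu] using (le_abs_self _).trans (f.le_opNorm u)
  obtain ⟨y₀, hy₀⟩ := exists_norm_eq B zero_le_one
  have hub : ∀ u : B, ‖u‖ = 1 → f u ≤ sSup {s : ℝ | ∃ u : B, ‖u‖ = 1 ∧ s = f u} :=
    fun u hu => le_csSup ⟨_, hle⟩ ⟨u, hu, rfl⟩
  have hub' : ∀ u : B, ‖u‖ = 1 → - f u ≤ sSup {s : ℝ | ∃ u : B, ‖u‖ = 1 ∧ s = f u} :=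
    fun u hu => by simpa using hub (-u) (by simpa using hu)
  refine le_antisymm (csSup_le ⟨_, y₀, hy₀, rfl⟩ hle) (f.opNorm_le_of_unit_norm ?_ ?_)
  · linarith [hub y₀ hy₀, hub' y₀ hy₀]
  · intro u hu
    rw [Real.norm_eq_abs, abs_le']
    exact ⟨hub u hu, hub' u hu⟩

/-- On a smooth normed space the duality map is norm-to-weak-* continuous away from `0`. -/
theorem tendsto_dualityMap_apply {B : Type*} [NormedAddCommGroup B] [NormedSpace ℝ B]
    (j : B → (B →L[ℝ] ℝ)) (hjn : ∀ v : B, v ≠ 0 → ‖j v‖ = 1)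
    (hjv : ∀ v : B, v ≠ 0 → j v v = ‖v‖)
    (hjuniq : ∀ v : B, v ≠ 0 → ∀ f : B →L[ℝ] ℝ, ‖f‖ = 1 → f v = ‖v‖ → f = j v)
    {w : B} (hw : w ≠ 0) (y : B) : Tendsto (fun x => j x y) (𝓝 w) (𝓝 (j w y)) := by
  rw [tendsto_iff_ultrafilter]
  intro U hU
  have hne : ∀ᶠ x in (U : Filter B), x ≠ 0 := hU (isOpen_ne.mem_nhds hw)
  have hcpt := WeakDual.isCompact_closedBall (𝕜 := ℝ) (E := B) 0 1
  obtain ⟨f, hf, hfU⟩ := hcpt.ultrafilter_le_nhds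
    (U.map fun x => StrongDual.toWeakDual (j x)) (by
      rw [le_principal_iff]
      change ∀ᶠ x in (U : Filter B), _
      filter_upwards [hne] with x hx
      simp [hjn x hx])
  have hlim : ∀ z, Tendsto (fun x => j x z) U (𝓝 (f z)) := fun z =>
    ((WeakDual.eval_continuous z).tendsto f).comp
      (show Tendsto (fun x => StrongDual.toWeakDual (j x)) U (𝓝 f) from hfU)
  have hfn : ‖WeakDual.toStrongDual f‖ ≤ 1 := by simpa using hf
  have hx : Tendsto (fun x => x) (U : Filter B) (𝓝 w) := hU
  have hfw : f w = ‖w‖ := by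
    have h1 : Tendsto (fun x => j x w - ‖x‖) U (𝓝 0) := by
      refine squeeze_zero_norm' (a := fun x => ‖w - x‖) ?_ ?_
      · filter_upwards [hne] with x hx
        rw [← hjv x hx, ← map_sub]
        simpa [hjn x hx] using (j x).le_opNorm (w - x)
      · simpa using (tendsto_const_nhds (x := w)).sub hx |>.norm
    have h2 := h1.add hx.norm
    simp only [sub_add_cancel, zero_add] at h2
    exact tendsto_nhds_unique (hlim w) h2
  have hf1 : ‖WeakDual.toStrongDual f‖ = 1 := by
    refine le_antisymm hfn ?_
    have h := (WeakDual.toStrongDual f).le_opNorm w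
    rw [WeakDual.toStrongDual_apply, hfw, norm_norm] at h
    exact le_of_mul_le_mul_right (by simpa using h) (norm_pos_iff.2 hw)
  have hfj := hjuniq w hw _ hf1 hfw
  rw [← hfj]
  exact hlim y

theorem continuous_norm_rpow_mul_dualityMap_apply {B : Type*} [NormedAddCommGroup B]
    [NormedSpace ℝ B] (j : B → (B →L[ℝ] ℝ)) (hj0 : j 0 = 0)
    (hjn : ∀ v : B, v ≠ 0 → ‖j v‖ = 1) (hjv : ∀ v : B, v ≠ 0 → j v v = ‖v‖)
    (hjuniq : ∀ v : B, v ≠ 0 → ∀ f : B →L[ℝ] ℝ, ‖f‖ = 1 → f v = ‖v‖ → f = j v)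
    {r : ℝ} (hr : 0 < r) (y : B) : Continuous fun w => ‖w‖ ^ r * j w y := by
  have hpow : Continuous fun w : B => ‖w‖ ^ r :=
    continuous_norm.rpow_const fun _ => Or.inr hr.le
  rw [continuous_iff_continuousAt]
  intro w
  rcases eq_or_ne w 0 with rfl | hw
  · have hle : ∀ x : B, ‖‖x‖ ^ r * j x y‖ ≤ ‖x‖ ^ r * ‖y‖ := by
      intro x
      rw [norm_mul, Real.norm_of_nonneg (by positivity)]
      gcongr
      refine ((j x).le_opNorm y).trans (mul_le_of_le_one_left (norm_nonneg _) ?_)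
      rcases eq_or_ne x 0 with rfl | hx
      · simp [hj0]
      · exact (hjn x hx).le
    have h0 : Tendsto (fun x : B => ‖x‖ ^ r * ‖y‖) (𝓝 0) (𝓝 0) := by
      simpa [hr.ne'] using (hpow.mul_const ‖y‖).tendsto 0
    simpa [ContinuousAt, hj0] using squeeze_zero_norm hle h0
  · exact (hpow.tendsto w).mul (tendsto_dualityMap_apply j hjn hjv hjuniq hw y)

theorem sum_mul_rpow_sub_one_le {ι : Type*} (s : Finset ι) (m a b : ι → ℝ) {p : ℝ}
    (hp : 1 < p) (hm : ∀ i ∈ s, 0 ≤ m i) (ha : ∀ i ∈ s, 0 ≤ a i) (hb : ∀ i ∈ s, 0 ≤ b i) :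
    ∑ i ∈ s, b i ^ (p - 1) * a i * m i ≤
      (∑ i ∈ s, a i ^ p * m i) ^ (1 / p) * ((∑ i ∈ s, b i ^ p * m i) ^ (1 / p)) ^ (p - 1) := by
  have hp0 : 0 < p := by linarith
  have hp1 : 0 < p - 1 := by linarith
  have hpq := Real.HolderConjugate.conjExponent hp
  have hq : Real.conjExponent p = p / (p - 1) := rfl
  have h := Real.inner_le_Lp_mul_Lq_of_nonneg s hpq
    (f := fun i => a i * m i ^ (1 / p)) (g := fun i => b i ^ (p - 1) * m i ^ ((p - 1) / p))
    (fun i hi => mul_nonneg (ha i hi) (Real.rpow_nonneg (hm i hi) _))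
    (fun i hi => mul_nonneg (Real.rpow_nonneg (hb i hi) _) (Real.rpow_nonneg (hm i hi) _))
  have h1 : ∀ i ∈ s, a i * m i ^ (1 / p) * (b i ^ (p - 1) * m i ^ ((p - 1) / p)) =
      b i ^ (p - 1) * a i * m i := by
    intro i hi
    have : m i ^ (1 / p) * m i ^ ((p - 1) / p) = m i := by
      rw [← Real.rpow_add_of_nonneg (hm i hi) (by positivity) (by positivity),
        ← add_div, add_sub_cancel, div_self hp0.ne', Real.rpow_one]
    linear_combination a i * b i ^ (p - 1) * this
  have h2 : ∀ i ∈ s, (a i * m i ^ (1 / p)) ^ p = a i ^ p * m i := by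
    intro i hi
    rw [Real.mul_rpow (ha i hi) (Real.rpow_nonneg (hm i hi) _), ← Real.rpow_mul (hm i hi),
      one_div_mul_cancel hp0.ne', Real.rpow_one]
  have h3 : ∀ i ∈ s, (b i ^ (p - 1) * m i ^ ((p - 1) / p)) ^ Real.conjExponent p =
      b i ^ p * m i := by
    intro i hi
    rw [Real.mul_rpow (Real.rpow_nonneg (hb i hi) _) (Real.rpow_nonneg (hm i hi) _),
      ← Real.rpow_mul (hm i hi), ← Real.rpow_mul (hb i hi), hq, mul_div_cancel₀ _ hp1.ne',
      div_mul_div_cancel₀ hp0.ne', div_self hp1.ne', Real.rpow_one]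
  rw [Finset.sum_congr rfl h1, Finset.sum_congr rfl h2, Finset.sum_congr rfl h3] at h
  have hS : 0 ≤ ∑ i ∈ s, b i ^ p * m i :=
    Finset.sum_nonneg fun i hi => mul_nonneg (Real.rpow_nonneg (hb i hi) _) (hm i hi)
  rw [← Real.rpow_mul hS, one_div_mul_eq_div]
  rwa [hq, one_div_div] at h

theorem dualityMap_comp_eq_neg {B : Type*} [NormedAddCommGroup B] [NormedSpace ℝ B]
    (j : B → (B →L[ℝ] ℝ)) (hj0 : j 0 = 0)
    (hjn : ∀ v : B, v ≠ 0 → ‖j v‖ = 1) (hjv : ∀ v : B, v ≠ 0 → j v v = ‖v‖)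
    (hjuniq : ∀ v : B, v ≠ 0 → ∀ f : B →L[ℝ] ℝ, ‖f‖ = 1 → f v = ‖v‖ → f = j v)
    (e : B ≃ₗᵢ[ℝ] B) (w y : B) : j (-e w) (e y) = - j w y := by
  rcases eq_or_ne w 0 with rfl | hw
  · simp [hj0]
  have hw' : -e w ≠ 0 := by simpa using hw
  have h := hjuniq w hw (-((j (-e w)).comp (e.toContinuousLinearEquiv : B →L[ℝ] B))) (by
    rw [norm_neg]
    exact ((j (-e w)).opNorm_comp_linearIsometryEquiv e).trans (hjn _ hw')) (by
    have := hjv _ hw'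
    simpa using this)
  rw [← h]
  simp

/-- Affine isometric actions with linear part `π` correspond exactly to `π`-cocycles
`c : Γ → B` via `α(γ)v = π(γ)v + c(γ)`. -/
theorem stmt13 {B : Type*} [NormedAddCommGroup B] [NormedSpace ℝ B] [CompleteSpace B]
    -- `B` is strictly convex:
    (hB : ∀ v u : B, v ≠ u → ‖v‖ ≤ 1 → ‖u‖ ≤ 1 → ‖v + u‖ < 2)
    -- `B` is smooth, with duality map `j`:
    (j : B → (B →L[ℝ] ℝ)) (hj0 : j 0 = 0)
    (hjn : ∀ v : B, v ≠ 0 → ‖j v‖ = 1)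
    (hjv : ∀ v : B, v ≠ 0 → j v v = ‖v‖)
    (hjuniq : ∀ v : B, v ≠ 0 → ∀ f : B →L[ℝ] ℝ, ‖f‖ = 1 → f v = ‖v‖ → f = j v)
    {Γ : Type*} [Group Γ] (K : Finset Γ)
    (hKsym : ∀ γ ∈ K, γ⁻¹ ∈ K)
    (hKgen : Subgroup.closure (K : Set Γ) = ⊤)
    -- `m` is a symmetric weight on `K`:
    (m : Γ → ℝ) (hmpos : ∀ γ ∈ K, 0 < m γ) (hmsym : ∀ γ ∈ K, m γ = m γ⁻¹)
    (hmsum : ∑ γ ∈ K, m γ = 1)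
    -- `α = π + c` is an affine isometric action of `Γ` on `B` with linear part `π`:
    (π : Γ →* (B ≃ₗᵢ[ℝ] B)) (c : Γ → B)
    (hc : ∀ γ γ' : Γ, c (γ * γ') = π γ (c γ') + c γ)
    (p : ℝ) (hp : 1 < p)
    (v : B) (hv : 0 < dispR K m (fun γ w => π γ w + c γ) p v) :
    absGrad (dispR K m (fun γ w => π γ w + c γ) p) v =
        (1 / dispR K m (fun γ w => π γ w + c γ) p v ^ (p - 1)) *
          sSup {s : ℝ | ∃ u : B, ‖u‖ = 1 ∧
            s = ∑ γ ∈ K, ‖π γ v + c γ - v‖ ^ (p - 1) * j (π γ v + c γ - v) (π γ u - u) * m γ} ∧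
      absGrad (dispR K m (fun γ w => π γ w + c γ) p) v =
        (2 / dispR K m (fun γ w => π γ w + c γ) p v ^ (p - 1)) *
          ‖∑ γ ∈ K, (‖π γ v + c γ - v‖ ^ (p - 1) * m γ) • j (π γ v + c γ - v)‖ := by
  set F := dispR K m (fun γ w => π γ w + c γ) p with hF
  have hp0 : 0 < p := by linarith
  have hp1 : 0 < p - 1 := by linarith
  have hm : ∀ γ ∈ K, 0 ≤ m γ := fun γ hγ => (hmpos γ hγ).le
  have hFdef : ∀ u, F u = (∑ γ ∈ K, ‖π γ u + c γ - u‖ ^ p * m γ) ^ (1 / p) := fun u => rfl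
  have hjle : ∀ x y : B, j x y ≤ ‖y‖ := by
    intro x y
    refine (le_abs_self _).trans (((j x).le_opNorm y).trans
      (mul_le_of_le_one_left (norm_nonneg _) ?_))
    rcases eq_or_ne x 0 with rfl | hx
    · simp [hj0]
    · exact (hjn x hx).le
  have hjself : ∀ x : B, j x x = ‖x‖ := by
    intro x
    rcases eq_or_ne x 0 with rfl | hx
    · simp
    · exact hjv x hx
  have hFpow : ∀ u, ∑ γ ∈ K, ‖π γ u + c γ - u‖ ^ p * m γ = F u ^ p := by
    intro u
    rw [hFdef, ← Real.rpow_mul (Finset.sum_nonneg fun γ hγ => mul_nonneg (by positivity) (hm γ hγ)),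
      one_div_mul_cancel hp0.ne', Real.rpow_one]
  have hFcont : Continuous F := by
    have hsum : Continuous fun u : B => ∑ γ ∈ K, ‖π γ u + c γ - u‖ ^ p * m γ := by
      refine continuous_finsetSum _ fun γ _ => Continuous.mul_const ?_ _
      refine Continuous.rpow_const ?_ fun _ => Or.inr hp0.le
      exact ((((π γ).continuous.add continuous_const).sub continuous_id).norm)
    exact hsum.rpow_const fun _ => Or.inr (by positivity)
  have hnt : Nontrivial B := by
    by_contra h
    rw [not_nontrivial_iff_subsingleton] at h
    have h0 : F v = 0 := by
      rw [hFdef, Finset.sum_eq_zero, Real.zero_rpow (by positivity)]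
      intro γ _
      rw [Subsingleton.elim (π γ v + c γ - v) 0, norm_zero, Real.zero_rpow hp0.ne', zero_mul]
    exact hv.ne' h0
  let ψ : B → (B →L[ℝ] ℝ) := fun u => ∑ γ ∈ K, (‖π γ u + c γ - u‖ ^ (p - 1) * m γ) •
    (j (π γ u + c γ - u)).comp
      (((π γ).toContinuousLinearEquiv : B →L[ℝ] B) - ContinuousLinearMap.id ℝ B)
  have hψ : ∀ u y, ψ u y = ∑ γ ∈ K,
      ‖π γ u + c γ - u‖ ^ (p - 1) * j (π γ u + c γ - u) (π γ y - y) * m γ := by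
    intro u y
    simp only [ψ, FunLike.coe_sum, Finset.sum_apply]
    refine Finset.sum_congr rfl fun γ _ => ?_
    simp
    ring
  let φ : B → (B →L[ℝ] ℝ) := fun u => (1 / F u ^ (p - 1)) • ψ u
  have hφ : ∀ u y, φ u y = 1 / F u ^ (p - 1) * ψ u y := fun u y => rfl
  have hsub : ∀ᶠ u in 𝓝 v, ∀ w, F u + φ u (w - u) ≤ F w := by
    filter_upwards [hFcont.continuousAt.eventually (lt_mem_nhds hv)] with u hu w
    have hG : 0 < F u ^ (p - 1) := Real.rpow_pos_of_pos hu _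
    have h1 := sum_mul_rpow_sub_one_le K m (fun γ => ‖π γ w + c γ - w‖)
      (fun γ => ‖π γ u + c γ - u‖) hp hm (fun _ _ => norm_nonneg _) (fun _ _ => norm_nonneg _)
    rw [← hFdef, ← hFdef] at h1
    have h2 : F u * F u ^ (p - 1) + ψ u (w - u) ≤
        ∑ γ ∈ K, ‖π γ u + c γ - u‖ ^ (p - 1) * ‖π γ w + c γ - w‖ * m γ := by
      have hFu : F u * F u ^ (p - 1) = F u ^ p := by
        rw [mul_comm, ← Real.rpow_add_one hu.ne', sub_add_cancel]
      rw [hFu, ← hFpow, hψ, ← Finset.sum_add_distrib]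
      refine Finset.sum_le_sum fun γ hγ => ?_
      rw [← add_mul]
      refine mul_le_mul_of_nonneg_right ?_ (hm γ hγ)
      have h3 : ‖π γ u + c γ - u‖ ^ p = ‖π γ u + c γ - u‖ ^ (p - 1) *
          j (π γ u + c γ - u) (π γ u + c γ - u) := by
        rw [hjself]
        nth_rewrite 3 [← Real.rpow_one ‖π γ u + c γ - u‖]
        rw [← Real.rpow_add_of_nonneg (norm_nonneg _) hp1.le zero_le_one, sub_add_cancel]
      rw [h3, ← mul_add, ← map_add]
      refine mul_le_mul_of_nonneg_left ?_ (by positivity)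
      refine (hjle _ _).trans (le_of_eq ?_)
      congr 1
      rw [map_sub]
      abel
    rw [hφ, ← mul_le_mul_iff_left₀ hG, add_mul, one_div, mul_right_comm, inv_mul_cancel₀ hG.ne',
      one_mul]
    exact h2.trans h1
  have hlim : ∀ y, Tendsto (fun u => φ u y) (𝓝 v) (𝓝 (φ v y)) := by
    intro y
    have hψc : Continuous fun u => ψ u y := by
      simp only [hψ]
      refine continuous_finsetSum _ fun γ _ => Continuous.mul_const ?_ _
      exact (continuous_norm_rpow_mul_dualityMap_apply j hj0 hjn hjv hjuniq hp1 _).comp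
        (((π γ).continuous.add continuous_const).sub continuous_id)
    have hG : Tendsto (fun u => F u ^ (p - 1)) (𝓝 v) (𝓝 (F v ^ (p - 1))) :=
      (hFcont.rpow_const fun _ => Or.inr hp1.le).tendsto v
    exact (tendsto_const_nhds.div hG (Real.rpow_pos_of_pos hv _).ne').mul (hψc.tendsto v)
  have hG : 0 < F v ^ (p - 1) := Real.rpow_pos_of_pos hv _
  have hgrad : absGrad F v = 1 / F v ^ (p - 1) * ‖ψ v‖ := by
    rw [absGrad, limsup_slope_eq_opNorm F φ v hsub hlim, max_eq_left (norm_nonneg _)]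
    change ‖(1 / F v ^ (p - 1)) • ψ v‖ = _
    rw [norm_smul, Real.norm_of_nonneg (by positivity)]
  refine ⟨?_, ?_⟩
  · rw [hgrad, ← sSup_image_unit_eq_opNorm]
    simp only [hψ]
  · have hc1 : c 1 = 0 := by simpa using hc 1 1
    have hD : ∀ γ, π γ v + c γ - v = -π γ (π γ⁻¹ v + c γ⁻¹ - v) := by
      intro γ
      have h1 := hc γ γ⁻¹
      rw [mul_inv_cancel, hc1] at h1
      have h2 : π γ (π γ⁻¹ v) = v := by
        change (π γ * π γ⁻¹) v = v
        rw [← map_mul, mul_inv_cancel, map_one]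
        rfl
      rw [map_sub, map_add, h2, eq_neg_of_add_eq_zero_left h1.symm]
      abel
    have hψT : ψ v = (-2 : ℝ) •
        ∑ γ ∈ K, (‖π γ v + c γ - v‖ ^ (p - 1) * m γ) • j (π γ v + c γ - v) := by
      ext y
      have hinv : ∑ γ ∈ K, ‖π γ v + c γ - v‖ ^ (p - 1) * m γ * j (π γ v + c γ - v) (π γ y) =
          ∑ γ ∈ K, -(‖π γ v + c γ - v‖ ^ (p - 1) * m γ * j (π γ v + c γ - v) y) := by
        refine Finset.sum_bij' (fun γ _ => γ⁻¹) (fun γ _ => γ⁻¹) hKsym hKsym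
          (fun γ _ => inv_inv γ) (fun γ _ => inv_inv γ) fun γ hγ => ?_
        rw [hD γ, dualityMap_comp_eq_neg j hj0 hjn hjv hjuniq, norm_neg,
          LinearIsometryEquiv.norm_map, hmsym γ hγ, mul_neg]
      rw [hψ]
      simp only [FunLike.coe_smul, FunLike.coe_sum, Finset.sum_apply, Pi.smul_apply,
        smul_eq_mul, map_sub]
      rw [neg_mul, two_mul, neg_add, ← Finset.sum_neg_distrib]
      nth_rewrite 1 [← hinv]
      rw [← Finset.sum_add_distrib]
      exact Finset.sum_congr rfl fun γ _ => by ring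
    rw [hgrad, hψT, norm_smul]
    norm_num
    ring
end
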